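/- arXiv:2402.13078 — 2 statements merged into one kernel-verified Lean document; each statement's English description precedes it below -/
import Mathlib

section
/- Let Ω ⊆ ℝ^N be open and C ⊆ Ω. The following are equivalent: (a) C is BV-polar in Ω, i.e. there exists u ∈ BV(Ω) with C ⊆ {x ∈ Ω : the approximate limit ũ(x) exists and |ũ(x)| = +∞}; (b) H^{N-1}(C) = 0; (c) there exists a sequence of open sets U_k ⊆ Ω containing C with λ^N(U_k) → 0 and P(U_k,Ω) → 0. -/
open MeasureTheory Metric Filter Set
open scoped ENNReal Topology symmDiff

noncomputable section

abbrev Euc (N : ℕ) : Type := EuclideanSpace ℝ (Fin N)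

variable {N : ℕ}

/-- The divergence of a vector field `φ : ℝ^N → ℝ^N`. -/
def diverg (φ : Euc N → Euc N) (x : Euc N) : ℝ :=
  ∑ i : Fin N, fderiv ℝ φ x (EuclideanSpace.single i 1) i

/-- The admissible test vector fields for the variation in `Ω`:
`C^1`, compactly supported in `Ω`, with `‖φ‖ ≤ 1`. -/
def TestVF (Ω : Set (Euc N)) : Set (Euc N → Euc N) :=
  {φ | ContDiff ℝ 1 φ ∧ HasCompactSupport φ ∧ tsupport φ ⊆ Ω ∧ ∀ x, ‖φ x‖ ≤ 1}

/-- The total variation `V(u, Ω)`. -/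
def variation (u : Euc N → ℝ) (Ω : Set (Euc N)) : ℝ≥0∞ :=
  ⨆ φ ∈ TestVF Ω, ENNReal.ofReal (∫ x in Ω, u x * diverg φ x)

/-- The perimeter `P(A, Ω)` of `A` in `Ω`. -/
def perimeter (A Ω : Set (Euc N)) : ℝ≥0∞ :=
  ⨆ φ ∈ TestVF Ω, ENNReal.ofReal (∫ x in A, diverg φ x)

/-- `u ∈ BV(Ω)`. -/
def MemBV (u : Euc N → ℝ) (Ω : Set (Euc N)) : Prop :=
  IntegrableOn u Ω volume ∧ variation u Ω < ⊤

/-- `u ∈ BV_loc(Ω)`. -/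
def MemBVloc (u : Euc N → ℝ) (Ω : Set (Euc N)) : Prop :=
  ∀ Ω' : Set (Euc N), IsOpen Ω' → IsCompact (closure Ω') → closure Ω' ⊆ Ω → MemBV u Ω'

/-- `u ∈ GBV(Ω)`: measurable, and every truncation `(-m) ∨ u ∧ m` is in `BV_loc(Ω)`. -/
def MemGBV (u : Euc N → ℝ) (Ω : Set (Euc N)) : Prop :=
  AEMeasurable u (volume.restrict Ω) ∧
    ∀ m : ℝ, 0 < m → MemBVloc (fun x => max (-m) (min (u x) m)) Ω

/-- `A` has locally finite perimeter in `Ω`. -/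
def HasLocFinPerimeter (A Ω : Set (Euc N)) : Prop :=
  ∀ Ω' : Set (Euc N), IsOpen Ω' → IsCompact (closure Ω') → closure Ω' ⊆ Ω →
    perimeter A Ω' < ⊤

/-- `A` has density `t` at `x`. -/
def HasDensity (A : Set (Euc N)) (x : Euc N) (t : ℝ) : Prop :=
  Tendsto (fun ρ : ℝ => volume (A ∩ ball x ρ) / volume (ball x ρ)) (𝓝[>] 0)
    (𝓝 (ENNReal.ofReal t))

/-- The approximate upper limit `u⁺(x)` of `u` at `x` (relative to `Ω`), with `inf ∅ = ⊤`. -/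
def approxUpper (u : Euc N → ℝ) (Ω : Set (Euc N)) (x : Euc N) : EReal :=
  sInf {t : EReal | ∃ s : ℝ, t = (s : EReal) ∧ HasDensity {y | y ∈ Ω ∧ s < u y} x 0}

/-- The approximate lower limit `u⁻(x)` of `u` at `x` (relative to `Ω`), with `sup ∅ = ⊥`. -/
def approxLower (u : Euc N → ℝ) (Ω : Set (Euc N)) (x : Euc N) : EReal :=
  sSup {t : EReal | ∃ s : ℝ, t = (s : EReal) ∧ HasDensity {y | y ∈ Ω ∧ u y < s} x 0}

/-- The approximate limit `ũ(x)` exists (i.e. `u⁺(x) = u⁻(x)`) and is `+∞`. -/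
def HasApproxLimitTop (u : Euc N → ℝ) (Ω : Set (Euc N)) (x : Euc N) : Prop :=
  approxUpper u Ω x = ⊤ ∧ approxLower u Ω x = ⊤

/-- The approximate limit `ũ(x)` exists and `|ũ(x)| = +∞`. -/
def HasInfApproxLimit (u : Euc N → ℝ) (Ω : Set (Euc N)) (x : Euc N) : Prop :=
  (approxUpper u Ω x = ⊤ ∧ approxLower u Ω x = ⊤) ∨
    (approxUpper u Ω x = ⊥ ∧ approxLower u Ω x = ⊥)

/-- `C` is `L⁰`-polar in `Ω`. -/
def L0Polar (C Ω : Set (Euc N)) : Prop :=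
  ∃ u : Euc N → ℝ, AEMeasurable u (volume.restrict Ω) ∧
    C ⊆ {x | x ∈ Ω ∧ HasInfApproxLimit u Ω x}

/-- `C` is `BV`-polar in `Ω`. -/
def BVPolar (C Ω : Set (Euc N)) : Prop :=
  ∃ u : Euc N → ℝ, MemBV u Ω ∧ C ⊆ {x | x ∈ Ω ∧ HasInfApproxLimit u Ω x}

/-- `C` is `GBV`-polar in `Ω`. -/
def GBVPolar (C Ω : Set (Euc N)) : Prop :=
  ∃ u : Euc N → ℝ, MemGBV u Ω ∧ C ⊆ {x | x ∈ Ω ∧ HasInfApproxLimit u Ω x}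

/-- The set `A^{(1)}` of points of `Ω` where `A` has density `1`. -/
def densityOne (A Ω : Set (Euc N)) : Set (Euc N) :=
  {x | x ∈ Ω ∧ HasDensity A x 1}

lemma diverg_eq (φ : Euc N → Euc N) : diverg φ = fun x => ∑ i : Fin N, fderiv ℝ φ x (EuclideanSpace.single i 1) i := rfl

lemma diverg_continuous {φ : Euc N → Euc N} (h : ContDiff ℝ 1 φ) : Continuous (diverg φ) := by
  rw [diverg_eq]
  have := h.continuous_fderiv (by norm_num)
  fun_prop

lemma diverg_zero {φ : Euc N → Euc N} {x : Euc N} (hx : x ∉ tsupport φ) : diverg φ x = 0 := by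
  have : fderiv ℝ φ x = 0 := by
    by_contra h
    exact hx (support_fderiv_subset ℝ h)
  simp [diverg, this]

lemma diverg_compact {φ : Euc N → Euc N} (h : HasCompactSupport φ) : HasCompactSupport (diverg φ) :=
  HasCompactSupport.intro h fun _ hx => diverg_zero hx

lemma diverg_integrable {φ : Euc N → Euc N} (h : ContDiff ℝ 1 φ) (hc : HasCompactSupport φ) :
    Integrable (diverg φ) :=
  (diverg_continuous h).integrable_of_hasCompactSupport (diverg_compact hc)

lemma coord_fderiv {φ : Euc N → Euc N} (h : ContDiff ℝ 1 φ) (x v : Euc N) (i : Fin N) :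
    fderiv ℝ (fun y => φ y i) x v = fderiv ℝ φ x v i := by
  have h1 : HasFDerivAt φ (fderiv ℝ φ x) x := (h.differentiable (by norm_num) x).hasFDerivAt
  have h2 := ((EuclideanSpace.proj i : Euc N →L[ℝ] ℝ).hasFDerivAt.comp x h1).fderiv
  exact congrArg (fun T : Euc N →L[ℝ] ℝ => T v) h2

lemma ibp {φ : Euc N → Euc N} (h : ContDiff ℝ 1 φ) (hc : HasCompactSupport φ)
    {g : Euc N → ℝ} (hg : ContDiff ℝ 1 g) :
    ∫ x, g x * diverg φ x = - ∫ x, fderiv ℝ g x (φ x) := by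
  have hgc := hg.continuous
  have hgd := hg.continuous_fderiv (by norm_num)
  have hφc := h.continuous
  have hφd := h.continuous_fderiv (by norm_num)
  have ci : ∀ i : Fin N, HasCompactSupport (fun y => φ y i) := fun i =>
    HasCompactSupport.intro hc fun x hx => by simp [image_eq_zero_of_notMem_tsupport hx]
  have ci' : ∀ i : Fin N, HasCompactSupport
    (fun x => fderiv ℝ φ x (EuclideanSpace.single i 1) i) := fun i =>
    HasCompactSupport.intro hc fun x hx => by
      have : fderiv ℝ φ x = 0 := by
        by_contra h
        exact hx (support_fderiv_subset ℝ h)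
      simp [this]
  have e1 : ∀ i : Fin N, Integrable (fun x => g x * fderiv ℝ φ x (EuclideanSpace.single i 1) i) :=
    fun i => Continuous.integrable_of_hasCompactSupport (by fun_prop) (ci' i).mul_left
  have e2 : ∀ i : Fin N, Integrable (fun x => fderiv ℝ g x (EuclideanSpace.single i 1) * φ x i) :=
    fun i => Continuous.integrable_of_hasCompactSupport (by fun_prop) (ci i).mul_left
  have e3 : ∀ i : Fin N, Integrable (fun x => g x * φ x i) :=
    fun i => Continuous.integrable_of_hasCompactSupport (by fun_prop) (ci i).mul_left
  have key : ∀ x, fderiv ℝ g x (φ x) = ∑ i, fderiv ℝ g x (EuclideanSpace.single i 1) * φ x i := by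
    intro x
    have : φ x = ∑ i, φ x i • EuclideanSpace.single i (1:ℝ) := by
      ext j
      simp [Finset.sum_apply, Pi.single_apply]
    conv_lhs => rw [this]
    rw [map_sum]
    refine Finset.sum_congr rfl fun i _ => ?_
    rw [map_smul, smul_eq_mul, mul_comm]
  simp_rw [key, diverg, Finset.mul_sum]
  rw [integral_finsetSum _ fun i _ => e1 i, integral_finsetSum _ fun i _ => e2 i,
    ← Finset.sum_neg_distrib]
  refine Finset.sum_congr rfl fun i _ => ?_
  have := integral_mul_fderiv_eq_neg_fderiv_mul_of_integrable (μ := volume) (f := g)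
    (g := fun y => φ y i) (v := EuclideanSpace.single i 1) (e2 i)
    (by simp_rw [coord_fderiv h]; exact e1 i) (e3 i)
    (fun x _ => hg.differentiable (by norm_num) x)
    (fun x _ => by
      have := h.differentiable (by norm_num)
      fun_prop)
  simp_rw [coord_fderiv h] at this
  exact this

def Appr (A : Set (Euc N)) (M : ℝ≥0∞) : Prop :=
  ∃ g : ℕ → Euc N → ℝ, (∀ k, ContDiff ℝ 1 (g k)) ∧ (∀ k x, 0 ≤ g k x ∧ g k x ≤ 1) ∧
    (∀ x, Tendsto (fun k => g k x) atTop (𝓝 (A.indicator (fun _ => (1:ℝ)) x))) ∧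
    ∀ k, ∫⁻ x, ‖fderiv ℝ (g k) x‖ₑ ≤ M

lemma Appr.empty : Appr (∅ : Set (Euc N)) 0 := by
  refine ⟨fun _ _ => 0, fun _ => contDiff_const, fun _ _ => by simp, fun x => by simp, fun k => ?_⟩
  have : ∀ x : Euc N, ‖fderiv ℝ (fun _ : Euc N => (0:ℝ)) x‖ₑ = 0 := fun x => by
    rw [← ofReal_norm]; simp
  simp only [this, lintegral_zero, le_refl]

lemma Appr.union {A B : Set (Euc N)} {M M' : ℝ≥0∞} (hA : Appr A M) (hB : Appr B M') :
    Appr (A ∪ B) (M + M') := by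
  obtain ⟨f, f1, f2, f3, f4⟩ := hA
  obtain ⟨g, g1, g2, g3, g4⟩ := hB
  refine ⟨fun k x => 1 - (1 - f k x) * (1 - g k x), fun k => ?_, fun k x => ?_, fun x => ?_,
    fun k => ?_⟩
  · have := f1 k; have := g1 k
    fun_prop
  · have := f2 k x; have := g2 k x
    constructor <;> nlinarith
  · have := ((tendsto_const_nhds (x := (1:ℝ))).sub
      (((tendsto_const_nhds (x := (1:ℝ))).sub (f3 x)).mul
      ((tendsto_const_nhds (x := (1:ℝ))).sub (g3 x))))
    convert this using 2
    by_cases ha : x ∈ A <;> by_cases hb : x ∈ B <;> simp [ha, hb]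
  · have hf : Continuous (fderiv ℝ (f k)) := (f1 k).continuous_fderiv (by norm_num)
    calc _ ≤ ∫⁻ x, (‖fderiv ℝ (f k) x‖ₑ + ‖fderiv ℝ (g k) x‖ₑ) := by
            refine lintegral_mono fun x => ?_
            have hf' := ((f1 k).differentiable (by norm_num) x).hasFDerivAt
            have hg' := ((g1 k).differentiable (by norm_num) x).hasFDerivAt
            have := (((hf'.const_sub 1).mul (hg'.const_sub 1)).const_sub 1).fderiv
            have e : fderiv ℝ (fun x => 1 - (1 - f k x) * (1 - g k x)) x
              = (1 - f k x) • fderiv ℝ (g k) x + (1 - g k x) • fderiv ℝ (f k) x := by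
              refine Eq.trans this ?_
              ext v; simp; ring
            show ‖fderiv ℝ (fun x => 1 - (1 - f k x) * (1 - g k x)) x‖ₑ ≤ _
            rw [e]
            have a1 := f2 k x; have a2 := g2 k x
            have n1 : ‖1 - f k x‖ ≤ 1 := by rw [Real.norm_eq_abs, abs_le]; constructor <;> linarith
            have n2 : ‖1 - g k x‖ ≤ 1 := by rw [Real.norm_eq_abs, abs_le]; constructor <;> linarith
            have n1' : ‖1 - f k x‖ₑ ≤ 1 := by
              rw [← ofReal_norm]; simpa using n1
            have n2' : ‖1 - g k x‖ₑ ≤ 1 := by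
              rw [← ofReal_norm]; simpa using n2
            refine (enorm_add_le ((1 - f k x) • fderiv ℝ (g k) x)
              ((1 - g k x) • fderiv ℝ (f k) x)).trans ?_
            rw [enorm_smul, enorm_smul, add_comm]
            exact add_le_add (mul_le_of_le_one_left' n2') (mul_le_of_le_one_left' n1')
      _ = (∫⁻ x, ‖fderiv ℝ (f k) x‖ₑ) + ∫⁻ x, ‖fderiv ℝ (g k) x‖ₑ :=
            lintegral_add_left hf.enorm.measurable _
      _ ≤ _ := add_le_add (f4 k) (g4 k)

lemma Appr.le {A : Set (Euc N)} {M : ℝ≥0∞} (hA : Appr A M) (hm : MeasurableSet A)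
    {φ : Euc N → Euc N} (h : ContDiff ℝ 1 φ) (hc : HasCompactSupport φ) (hb : ∀ x, ‖φ x‖ ≤ 1) :
    ENNReal.ofReal (∫ x in A, diverg φ x) ≤ M := by
  obtain ⟨f, f1, f2, f3, f4⟩ := hA
  have hi := diverg_integrable h hc
  have lim : Tendsto (fun k => ∫ x, f k x * diverg φ x) atTop (𝓝 (∫ x in A, diverg φ x)) := by
    rw [← integral_indicator hm]
    refine tendsto_integral_of_dominated_convergence (fun x => ‖diverg φ x‖) (fun k => ?_)
      hi.norm (fun k => ?_) ?_
    · exact ((f1 k).continuous.mul (diverg_continuous h)).aestronglyMeasurable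
    · refine Eventually.of_forall fun x => ?_
      rw [norm_mul]
      refine mul_le_of_le_one_left (norm_nonneg _) ?_
      rw [Real.norm_eq_abs, abs_le]
      have := f2 k x
      constructor <;> linarith
    · refine Eventually.of_forall fun x => ?_
      have := (f3 x).mul_const (diverg φ x)
      convert this using 2
      by_cases hx : x ∈ A <;> simp [hx]
  refine le_of_tendsto (ENNReal.tendsto_ofReal lim) (Eventually.of_forall fun k => ?_)
  rw [ibp h hc (f1 k), ← integral_neg]
  calc _ ≤ ENNReal.ofReal ‖∫ x, -fderiv ℝ (f k) x (φ x)‖ := ENNReal.ofReal_le_ofReal (le_abs_self _)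
    _ = ‖∫ x, -fderiv ℝ (f k) x (φ x)‖ₑ := ofReal_norm _
    _ ≤ ∫⁻ x, ‖-fderiv ℝ (f k) x (φ x)‖ₑ := enorm_integral_le_lintegral_enorm _
    _ ≤ ∫⁻ x, ‖fderiv ℝ (f k) x‖ₑ := by
      refine lintegral_mono fun x => ?_
      rw [enorm_neg]
      refine enorm_le_iff_norm_le.2 ?_
      exact ((fderiv ℝ (f k) x).le_opNorm _).trans (mul_le_of_le_one_right (norm_nonneg _) (hb x))
    _ ≤ M := f4 k

lemma smooth_deriv_zero {x : ℝ} (hx : x ∉ Icc (0:ℝ) 1) : deriv Real.smoothTransition x = 0 := by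
  rw [mem_Icc, not_and_or, not_le, not_le] at hx
  rcases hx with hx | hx
  · have : Real.smoothTransition =ᶠ[𝓝 x] fun _ => 0 := by
      filter_upwards [Iio_mem_nhds hx] with y hy
      exact Real.smoothTransition.zero_of_nonpos (le_of_lt hy)
    rw [this.deriv_eq]; simp
  · have : Real.smoothTransition =ᶠ[𝓝 x] fun _ => 1 := by
      filter_upwards [Ioi_mem_nhds hx] with y hy
      exact Real.smoothTransition.one_of_one_le (le_of_lt hy)
    rw [this.deriv_eq]; simp

lemma smooth_deriv_bound : ∃ L : ℝ, 0 ≤ L ∧ ∀ x, |deriv Real.smoothTransition x| ≤ L := by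
  have hc : Continuous (deriv Real.smoothTransition) :=
    (Real.smoothTransition.contDiff (n := 1)).continuous_deriv (by norm_num)
  obtain ⟨L, hL⟩ := (isCompact_Icc (a := (0:ℝ)) (b := 1)).exists_bound_of_continuousOn hc.continuousOn
  refine ⟨max L 0, le_max_right _ _, fun x => ?_⟩
  by_cases hx : x ∈ Icc (0:ℝ) 1
  · exact (hL x hx).trans (le_max_left _ _)
  · rw [smooth_deriv_zero hx]; simp

lemma annulus_volume {n : ℕ} (c : Euc (n+1)) {r : ℝ} (hr : 0 < r) {K : ℝ} (hK : 1 ≤ K) :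
    volume (closedBall c r \ ball c (r * (1 - 1/K))) ≤
      ENNReal.ofReal (volume.real (ball (0 : Euc (n+1)) 1) * (r^(n+1) * ((n+1) / K))) := by
  have hK0 : 0 < K := by linarith
  have h1K : 1 / K ≤ 1 := by rw [div_le_one hK0]; exact hK
  have h1K' : 0 ≤ 1 - 1/K := by linarith
  have hs : ball c (r * (1 - 1/K)) ⊆ closedBall c r := by
    refine ball_subset_closedBall.trans (closedBall_subset_closedBall ?_)
    have : 0 < 1/K := by positivity
    nlinarith
  rw [measure_sdiff hs measurableSet_ball.nullMeasurableSet measure_ball_lt_top.ne,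
    Measure.addHaar_closedBall _ _ hr.le, Measure.addHaar_ball _ c (r := r * (1 - 1/K)) (by positivity)]
  have hω : volume (ball (0 : Euc (n+1)) 1) = ENNReal.ofReal (volume.real (ball (0 : Euc (n+1)) 1)) := by
    rw [ofReal_measureReal measure_ball_lt_top.ne]
  set ω := volume.real (ball (0 : Euc (n+1)) 1)
  have hω0 : 0 ≤ ω := measureReal_nonneg
  rw [hω, ← ENNReal.ofReal_mul (by positivity), ← ENNReal.ofReal_mul (by positivity),
    ← ENNReal.ofReal_sub _ (by positivity)]
  refine ENNReal.ofReal_le_ofReal ?_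
  simp only [finrank_euclideanSpace, Fintype.card_fin]
  have bern := one_add_mul_le_pow (a := -(1/K)) (by linarith) (n+1)
  rw [mul_pow]
  have e : (1 - 1/K) = 1 + -(1/K) := by ring
  rw [e]
  have : 0 ≤ ω * r^(n+1) := by positivity
  have h2 : (1:ℝ) - (1 + -(1/K))^(n+1) ≤ (n+1)/K := by
    push_cast at bern
    have : ((n:ℝ)+1) * -(1/K) = -(((n:ℝ)+1)/K) := by ring
    linarith
  nlinarith [mul_le_mul_of_nonneg_left h2 this]

lemma Appr.ball {n : ℕ} : ∃ M : ℝ, 0 ≤ M ∧ ∀ (c : Euc (n+1)) (r : ℝ), 0 < r →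
    Appr (Metric.ball c r) (ENNReal.ofReal (M * r ^ n)) := by
  obtain ⟨L, hL0, hL⟩ := smooth_deriv_bound
  set ω := volume.real (Metric.ball (0 : Euc (n+1)) 1) with hω
  have hω0 : 0 ≤ ω := measureReal_nonneg
  refine ⟨2 * L * ω * (n+1), by positivity, fun c r hr => ?_⟩
  let a : ℕ → Euc (n+1) → ℝ := fun k x => (1 - ‖x - c‖^2 / r^2) * (k+1)
  have ha : ∀ k, ContDiff ℝ 1 (a k) := fun k => by
    have : ContDiff ℝ 1 (fun x : Euc (n+1) => ‖x - c‖^2) :=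
      (contDiff_id.sub contDiff_const).norm_sq ℝ
    exact (contDiff_const.sub (this.div_const _)).mul contDiff_const
  refine ⟨fun k x => Real.smoothTransition (a k x), fun k => ?_, fun k x =>
    ⟨Real.smoothTransition.nonneg _, Real.smoothTransition.le_one _⟩, fun x => ?_, fun k => ?_⟩
  · exact (Real.smoothTransition.contDiff (n := 1)).comp (ha k)
  · by_cases hx : x ∈ Metric.ball c r
    · rw [indicator_of_mem hx]
      have hx' : ‖x - c‖ < r := by rwa [mem_ball, dist_eq_norm] at hx
      have hpos : 0 < 1 - ‖x - c‖^2 / r^2 := by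
        rw [sub_pos, div_lt_one (by positivity)]
        exact pow_lt_pow_left₀ hx' (norm_nonneg _) (by norm_num)
      refine tendsto_const_nhds.congr' ?_
      have := (tendsto_natCast_atTop_atTop (R := ℝ)).const_mul_atTop hpos
      filter_upwards [this.eventually_ge_atTop 1] with k hk
      refine (Real.smoothTransition.one_of_one_le ?_).symm
      simp only [a]
      nlinarith
    · rw [indicator_of_notMem hx]
      have hx' : r ≤ ‖x - c‖ := by rwa [mem_ball, dist_eq_norm, not_lt] at hx
      have hpos : 1 - ‖x - c‖^2 / r^2 ≤ 0 := by
        rw [sub_nonpos, one_le_div (by positivity)]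
        exact pow_le_pow_left₀ hr.le hx' 2
      have : ∀ k, Real.smoothTransition (a k x) = 0 := fun k =>
        Real.smoothTransition.zero_of_nonpos (mul_nonpos_of_nonpos_of_nonneg hpos (by positivity))
      simp [this]
  · have hK : (1:ℝ) ≤ k + 1 := by linarith [k.cast_nonneg (α := ℝ)]
    set K : ℝ := k + 1 with hKdef
    have hK0 : 0 < K := by linarith
    have hder : ∀ x, fderiv ℝ (fun x => Real.smoothTransition (a k x)) x
        = deriv Real.smoothTransition (a k x) • ((-(2 * K / r^2)) • innerSL ℝ (x - c)) := by
      intro x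
      have h1 : HasFDerivAt (a k) ((-(2 * K / r^2)) • innerSL ℝ (x - c)) x := by
        have h0 : HasFDerivAt (fun x : Euc (n+1) => ‖x - c‖^2) (2 • innerSL ℝ (x - c)) x := by
          have := ((hasFDerivAt_id x).sub_const c).norm_sq
          simpa using this
        have h0' := ((h0.mul_const (r^2)⁻¹).const_sub 1).mul_const K
        have ed : (-(2 * K / r^2)) • innerSL ℝ (x - c) =
            K • -((r ^ 2)⁻¹ • 2 • (innerSL ℝ) (x - c)) := by
          ext v
          simp
          ring
        rw [ed]
        exact h0'
      have h2 : HasDerivAt Real.smoothTransition (deriv Real.smoothTransition (a k x)) (a k x) :=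
        ((Real.smoothTransition.contDiff (n := 1)).differentiable (by norm_num) _).hasDerivAt
      exact (h2.comp_hasFDerivAt x h1).fderiv
    have bound : ∀ x, ‖fderiv ℝ (fun x => Real.smoothTransition (a k x)) x‖ₑ ≤
        (closedBall c r \ Metric.ball c (r * (1 - 1/K))).indicator
          (fun _ => ENNReal.ofReal (L * (2 * K / r))) x := by
      intro x
      rw [hder]
      by_cases hm : a k x ∈ Icc (0:ℝ) 1
      · have hxr : ‖x - c‖ ≤ r := by
          have : 0 ≤ 1 - ‖x - c‖^2 / r^2 := nonneg_of_mul_nonneg_left hm.1 hK0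
          rw [sub_nonneg, div_le_one (by positivity)] at this
          exact le_of_sq_le_sq this hr.le
        have hxr' : r * (1 - 1/K) ≤ ‖x - c‖ := by
          by_contra hlt
          push Not at hlt
          have q : ‖x - c‖/r < 1 - 1/K := by rw [div_lt_iff₀ hr]; linarith
          have q0 : 0 ≤ ‖x - c‖/r := by positivity
          have q1 : (‖x - c‖/r)^2 ≤ ‖x-c‖/r := by
            have : 0 < 1/K := by positivity
            nlinarith
          have := hm.2
          have h3 : a k x = (1 - (‖x - c‖/r)^2) * K := by simp only [a, div_pow, hKdef]
          rw [h3] at this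
          have h4 : 1/K * K = 1 := by field_simp
          nlinarith
        have hmem : x ∈ closedBall c r \ Metric.ball c (r * (1 - 1/K)) := by
          rw [Set.mem_sdiff, mem_closedBall, mem_ball, dist_eq_norm, not_lt]
          exact ⟨hxr, hxr'⟩
        rw [indicator_of_mem hmem, ← ofReal_norm]
        refine ENNReal.ofReal_le_ofReal ?_
        rw [norm_smul, norm_smul, innerSL_apply_norm]
        have e : ‖-(2 * K / r^2)‖ = 2 * K / r^2 := by
          rw [norm_neg, Real.norm_eq_abs, abs_of_nonneg (by positivity)]
        rw [e]
        refine mul_le_mul (hL _) ?_ (by positivity) hL0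
        calc 2 * K / r^2 * ‖x - c‖ ≤ 2 * K / r^2 * r := by gcongr
          _ = 2 * K / r := by field_simp
      · rw [smooth_deriv_zero hm, zero_smul, ← ofReal_norm]
        simp
    calc _ ≤ ∫⁻ x, (closedBall c r \ Metric.ball c (r * (1 - 1/K))).indicator
          (fun _ => ENNReal.ofReal (L * (2 * K / r))) x := lintegral_mono bound
      _ = ENNReal.ofReal (L * (2 * K / r)) * volume (closedBall c r \ Metric.ball c (r * (1 - 1/K))) := by
        rw [lintegral_indicator (measurableSet_closedBall.diff measurableSet_ball), setLIntegral_const]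
      _ ≤ ENNReal.ofReal (L * (2 * K / r)) * ENNReal.ofReal (ω * (r^(n+1) * ((n+1) / K))) := by
        gcongr
        exact annulus_volume c hr hK
      _ = ENNReal.ofReal (2 * L * ω * (n+1) * r ^ n) := by
        rw [← ENNReal.ofReal_mul (by positivity)]
        congr 1
        field_simp
        ring

lemma Appr.biUnion {M : ℕ → ℝ≥0∞} {A : ℕ → Set (Euc N)} (h : ∀ i, Appr (A i) (M i)) (m : ℕ) :
    Appr (⋃ i ∈ Finset.range m, A i) (∑ i ∈ Finset.range m, M i) := by
  induction m with
  | zero => simpa using Appr.empty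
  | succ m ih =>
    rw [Finset.sum_range_succ]
    have : (⋃ i ∈ Finset.range (m+1), A i) = (⋃ i ∈ Finset.range m, A i) ∪ A m := by
      rw [Finset.range_add_one, Finset.set_biUnion_insert, union_comm]
    rw [this]
    exact ih.union (h m)

lemma perimeter_iUnion {M : ℕ → ℝ≥0∞} {A : ℕ → Set (Euc N)} (h : ∀ i, Appr (A i) (M i))
    (hm : ∀ i, MeasurableSet (A i)) (Ω : Set (Euc N)) :
    perimeter (Ω ∩ ⋃ i, A i) Ω ≤ ∑' i, M i := by
  refine iSup₂_le fun φ hφ => ?_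
  obtain ⟨h1, h2, h3, h4⟩ := hφ
  have hi := diverg_integrable h1 h2
  have e : ∫ x in Ω ∩ ⋃ i, A i, diverg φ x = ∫ x in ⋃ i, A i, diverg φ x := by
    rw [inter_comm]
    refine (setIntegral_eq_of_subset_of_forall_sdiff_eq_zero (MeasurableSet.iUnion hm)
      inter_subset_left fun x hx => diverg_zero fun hx' => hx.2 ⟨hx.1, h3 hx'⟩).symm
  rw [e]
  have lim : Tendsto (fun m => ∫ x in ⋃ i ∈ Finset.range m, A i, diverg φ x) atTop
      (𝓝 (∫ x in ⋃ m, ⋃ i ∈ Finset.range m, A i, diverg φ x)) := by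
    refine tendsto_setIntegral_of_monotone (fun m => ?_) (fun a b hab => ?_) hi.integrableOn
    · exact Finset.measurableSet_biUnion _ fun i _ => hm i
    · exact biUnion_subset_biUnion_left (by simpa using hab)
  have e2 : (⋃ m, ⋃ i ∈ Finset.range m, A i) = ⋃ i, A i := by
    ext x
    simp only [mem_iUnion, Finset.mem_range, exists_prop]
    exact ⟨fun ⟨m, i, _, h⟩ => ⟨i, h⟩, fun ⟨i, h⟩ => ⟨i+1, i, by omega, h⟩⟩
  rw [e2] at lim
  refine le_of_tendsto (ENNReal.tendsto_ofReal lim) (Eventually.of_forall fun m => ?_)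
  refine ((Appr.biUnion h m).le (Finset.measurableSet_biUnion _ fun i _ => hm i) h1 h2 h4).trans ?_
  exact ENNReal.sum_le_tsum _

lemma hcover {n : ℕ} (hn : 1 ≤ n) {C : Set (Euc (n+1))}
    (hC : (μH[(n : ℝ)] : Measure (Euc (n+1))) C = 0) {η : ℝ} (hη : 0 < η) :
    ∃ (c : ℕ → Euc (n+1)) (r : ℕ → ℝ), (∀ i, 0 < r i ∧ r i < η) ∧ C ⊆ ⋃ i, ball (c i) (r i) ∧
      ∑' i, ENNReal.ofReal (r i ^ n) ≤ ENNReal.ofReal η := by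
  have hn0 : (0:ℝ) < n := by exact_mod_cast hn
  rw [Measure.hausdorffMeasure_apply] at hC
  have hη2 : 0 < ENNReal.ofReal (η/2) := by simpa using hη
  have h1 : (⨅ (t : ℕ → Set (Euc (n+1))) (_ : C ⊆ ⋃ n, t n) (_ : ∀ n, ediam (t n) ≤ ENNReal.ofReal (η/2)),
          ∑' i, ⨆ _ : (t i).Nonempty, ediam (t i) ^ (n:ℝ)) < ENNReal.ofReal (η/2) := by
    refine lt_of_le_of_lt ?_ hη2
    rw [← hC]
    exact le_iSup₂_of_le (ENNReal.ofReal (η/2)) hη2 le_rfl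
  simp only [iInf_lt_iff] at h1
  obtain ⟨t, ht1, ht2, ht3⟩ := h1
  obtain ⟨e, he, hes⟩ := ENNReal.exists_pos_sum_of_countable hη2.ne' ℕ
  have hd : ∀ i, ediam (t i) ≠ ⊤ := fun i => ne_top_of_le_ne_top ENNReal.ofReal_ne_top (ht2 i)
  have hr : ∀ i, ∃ r : ℝ, (ediam (t i)).toReal < r ∧ r < η ∧
      r ^ n < (ediam (t i)).toReal ^ n + e i := by
    intro i
    set d := (ediam (t i)).toReal
    have hdη : d < η := by
      have := ENNReal.toReal_mono ENNReal.ofReal_ne_top (ht2 i)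
      rw [ENNReal.toReal_ofReal (by positivity)] at this
      show (ediam (t i)).toReal < η
      linarith
    have hc : Tendsto (fun r : ℝ => r ^ n) (𝓝[>] d) (𝓝 (d ^ n)) :=
      ((continuous_pow n).tendsto d).mono_left nhdsWithin_le_nhds
    have h2 := hc.eventually_lt_const (show d ^ n < d ^ n + e i by
      have : (0:ℝ) < e i := he i
      linarith)
    have h3 : ∀ᶠ r in 𝓝[>] d, r < η := nhdsWithin_le_nhds (Iio_mem_nhds hdη)
    obtain ⟨r, ha, hb, hc⟩ := ((eventually_mem_nhdsWithin (a := d) (s := Ioi d)).and (h3.and h2)).exists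
    exact ⟨r, ha, hb, hc⟩
  choose r hr1 hr2 hr3 using hr
  have hc : ∀ i, ∃ c : Euc (n+1), t i ⊆ ball c (r i) := by
    intro i
    rcases (t i).eq_empty_or_nonempty with h | ⟨c, hc⟩
    · exact ⟨0, by simp [h]⟩
    · refine ⟨c, fun y hy => ?_⟩
      rw [mem_ball]
      refine lt_of_le_of_lt ?_ (hr1 i)
      rw [dist_edist]
      exact ENNReal.toReal_mono (hd i) (edist_le_ediam_of_mem hy hc)
  choose c hc using hc
  refine ⟨c, r, fun i => ⟨lt_of_le_of_lt ENNReal.toReal_nonneg (hr1 i), hr2 i⟩,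
    ht1.trans (iUnion_mono hc), ?_⟩
  calc ∑' i, ENNReal.ofReal (r i ^ n) ≤
      ∑' i, ((⨆ _ : (t i).Nonempty, ediam (t i) ^ (n:ℝ)) + e i) := by
        refine ENNReal.tsum_le_tsum fun i => ?_
        refine (ENNReal.ofReal_le_ofReal (hr3 i).le).trans ?_
        rw [ENNReal.ofReal_add (by positivity) (by positivity), ENNReal.ofReal_coe_nnreal,
          ENNReal.ofReal_pow ENNReal.toReal_nonneg, ENNReal.ofReal_toReal (hd i)]
        gcongr
        rw [← ENNReal.rpow_natCast]
        rcases (t i).eq_empty_or_nonempty with h | h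
        · simp [h]; omega
        · exact le_iSup_of_le h le_rfl
    _ = (∑' i, ⨆ _ : (t i).Nonempty, ediam (t i) ^ (n:ℝ)) + ∑' i, (e i : ℝ≥0∞) := ENNReal.tsum_add
    _ ≤ ENNReal.ofReal (η/2) + ENNReal.ofReal (η/2) := add_le_add ht3.le hes.le
    _ = ENNReal.ofReal η := by
      rw [← ENNReal.ofReal_add (by positivity) (by positivity)]; congr 1; ring

lemma b_to_c {n : ℕ} (hn : 1 ≤ n) (Ω : Set (Euc (n+1))) (hΩ : IsOpen Ω) {C : Set (Euc (n+1))}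
    (hCΩ : C ⊆ Ω) (hC : (μH[(n : ℝ)] : Measure (Euc (n+1))) C = 0) :
    ∃ U : ℕ → Set (Euc (n+1)), (∀ k, IsOpen (U k) ∧ U k ⊆ Ω ∧ C ⊆ U k) ∧
        Tendsto (fun k => volume (U k)) atTop (𝓝 0) ∧
        Tendsto (fun k => perimeter (U k) Ω) atTop (𝓝 0) := by
  obtain ⟨M, hM0, hM⟩ := Appr.ball (n := n)
  have hη : ∀ k : ℕ, (0:ℝ) < 1 / ((k:ℝ) + 1) := fun k => by positivity
  choose c r hr hcov hsum using fun k : ℕ => hcover hn hC (hη k)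
  have lim : Tendsto (fun k : ℕ => ENNReal.ofReal (1 / ((k:ℝ) + 1))) atTop (𝓝 0) := by
    have := ENNReal.tendsto_ofReal (tendsto_one_div_add_atTop_nhds_zero_nat (𝕜 := ℝ))
    simpa using this
  refine ⟨fun k => Ω ∩ ⋃ i, ball (c k i) (r k i), fun k =>
    ⟨hΩ.inter (isOpen_iUnion fun i => isOpen_ball), inter_subset_left, subset_inter hCΩ (hcov k)⟩,
    ?_, ?_⟩
  · have l2 : Tendsto (fun k : ℕ => volume (ball (0 : Euc (n+1)) 1) *
        ENNReal.ofReal (1 / ((k:ℝ) + 1))) atTop (𝓝 0) := by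
      have := ENNReal.Tendsto.const_mul lim (Or.inr (measure_ball_lt_top (μ := volume)
        (x := (0 : Euc (n+1))) (r := 1)).ne)
      simpa using this
    refine tendsto_of_tendsto_of_tendsto_of_le_of_le tendsto_const_nhds l2 (fun _ => zero_le)
      fun k => ?_
    calc volume (Ω ∩ ⋃ i, ball (c k i) (r k i)) ≤ volume (⋃ i, ball (c k i) (r k i)) :=
          measure_mono inter_subset_right
      _ ≤ ∑' i, volume (ball (c k i) (r k i)) := measure_iUnion_le _
      _ ≤ ∑' i, volume (ball (0 : Euc (n+1)) 1) * ENNReal.ofReal (r k i ^ n) := by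
        refine ENNReal.tsum_le_tsum fun i => ?_
        rw [Measure.addHaar_ball _ _ (hr k i).1.le, mul_comm]
        refine mul_le_mul_right (ENNReal.ofReal_le_ofReal ?_) _
        rw [finrank_euclideanSpace, Fintype.card_fin]
        refine pow_le_pow_of_le_one (hr k i).1.le ?_ (by omega)
        refine (hr k i).2.le.trans ?_
        rw [div_le_one (by positivity)]
        linarith [k.cast_nonneg (α := ℝ)]
      _ = volume (ball (0 : Euc (n+1)) 1) * ∑' i, ENNReal.ofReal (r k i ^ n) := ENNReal.tsum_mul_left
      _ ≤ _ := by gcongr; exact hsum k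
  · have l2 : Tendsto (fun k : ℕ => ENNReal.ofReal M *
        ENNReal.ofReal (1 / ((k:ℝ) + 1))) atTop (𝓝 0) := by
      have := ENNReal.Tendsto.const_mul lim (Or.inr (ENNReal.ofReal_ne_top (r := M)))
      simpa using this
    refine tendsto_of_tendsto_of_tendsto_of_le_of_le tendsto_const_nhds l2 (fun _ => zero_le)
      fun k => ?_
    refine (perimeter_iUnion (fun i => hM (c k i) (r k i) (hr k i).1)
      (fun i => measurableSet_ball) Ω).trans ?_
    simp_rw [ENNReal.ofReal_mul hM0]
    rw [ENNReal.tsum_mul_left]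
    gcongr
    exact hsum k

lemma hausdorff_empty {d : ℝ} (hd : d ≤ 0) {C : Set (Euc N)}
    (hC : (μH[d] : Measure (Euc N)) C = 0) : C = ∅ := by
  by_contra h
  have h1 := Measure.one_le_hausdorffMeasure_zero_of_nonempty (nonempty_iff_ne_empty.2 h)
  have h2 := Measure.hausdorffMeasure_mono hd C
  rw [hC] at h2
  simpa using h1.trans h2

lemma perimeter_empty (Ω : Set (Euc N)) : perimeter (∅ : Set (Euc N)) Ω = 0 := by
  simp [perimeter]

lemma c_to_a (Ω : Set (Euc N)) (hΩ : IsOpen Ω) {C : Set (Euc N)} (hCΩ : C ⊆ Ω)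
    (h : ∃ U : ℕ → Set (Euc N), (∀ k, IsOpen (U k) ∧ U k ⊆ Ω ∧ C ⊆ U k) ∧
        Tendsto (fun k => volume (U k)) atTop (𝓝 0) ∧
        Tendsto (fun k => perimeter (U k) Ω) atTop (𝓝 0)) : BVPolar C Ω := by
  obtain ⟨U, hU, hv, hp⟩ := h
  obtain ⟨e, he, hes⟩ := ENNReal.exists_pos_sum_of_countable one_ne_zero ℕ
  have : ∀ j, ∃ k, volume (U k) < e j ∧ perimeter (U k) Ω < e j := fun j => by
    have hj : (0:ℝ≥0∞) < e j := by exact_mod_cast he j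
    exact ((hv.eventually_lt_const hj).and (hp.eventually_lt_const hj)).exists
  choose k hk1 hk2 using this
  set W : ℕ → Set (Euc N) := fun j => U (k j) with hW
  have hWo : ∀ j, IsOpen (W j) := fun j => (hU _).1
  have hWm : ∀ j, MeasurableSet (W j) := fun j => (hWo j).measurableSet
  let v : Euc N → ℝ≥0∞ := fun y => ∑' j, (W j).indicator (fun _ => (1:ℝ≥0∞)) y
  have hvm : Measurable v := Measurable.tsum fun j =>
    measurable_const.indicator (hWm j)
  have hvol : ∑' j, volume (W j) ≠ ⊤ :=
    ne_top_of_le_ne_top ENNReal.one_ne_top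
      ((ENNReal.tsum_le_tsum fun j => (hk1 j).le).trans hes.le)
  have hvi : ∫⁻ y, v y ≠ ⊤ := by
    rw [lintegral_tsum fun j => (measurable_const.indicator (hWm j)).aemeasurable]
    simpa [lintegral_indicator, hWm] using hvol
  have hfin : ∀ᵐ y, v y < ⊤ := ae_lt_top hvm hvi
  have hui : Integrable (fun y => (v y).toReal) :=
    integrable_toReal_of_lintegral_ne_top hvm.aemeasurable hvi
  have hbig : ∀ x ∈ C, ∀ s : ℝ, ∀ᶠ ρ in 𝓝[>] (0:ℝ),
      volume (ball x ρ \ {y | y ∈ Ω ∧ s < (v y).toReal}) = 0 := by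
    intro x hx s
    obtain ⟨m, hm⟩ := exists_nat_gt s
    have hop : IsOpen (⋂ j ∈ Finset.range m, W j) := isOpen_biInter_finset fun j _ => hWo j
    have hxm : x ∈ Ω ∩ ⋂ j ∈ Finset.range m, W j :=
      ⟨hCΩ hx, mem_iInter₂.2 fun j _ => (hU _).2.2 hx⟩
    obtain ⟨ε, hε, hsub⟩ := Metric.isOpen_iff.1 (hΩ.inter hop) x hxm
    have : ∀ᶠ ρ in 𝓝[>] (0:ℝ), ρ < ε := nhdsWithin_le_nhds (Iio_mem_nhds hε)
    filter_upwards [this] with ρ hρ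
    refine measure_mono_null ?_ hfin
    intro y hy hlt
    have hy1 := hsub (ball_subset_ball hρ.le hy.1)
    refine hy.2 ⟨hy1.1, hm.trans_le ?_⟩
    have : (m : ℝ≥0∞) ≤ v y := by
      refine le_trans ?_ (ENNReal.sum_le_tsum (Finset.range m))
      have : ∀ j ∈ Finset.range m, (W j).indicator (fun _ => (1:ℝ≥0∞)) y = 1 := fun j hj =>
        indicator_of_mem (mem_iInter₂.1 hy1.2 j hj) _
      rw [Finset.sum_congr rfl this]
      simp
    have := ENNReal.toReal_mono hlt.ne this
    simpa using this
  refine ⟨fun y => (v y).toReal, ⟨hui.integrableOn, ?_⟩, fun x hx => ⟨hCΩ hx, Or.inl ⟨?_, ?_⟩⟩⟩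
  · refine lt_of_le_of_lt ?_ ENNReal.one_lt_top
    refine iSup₂_le fun φ hφ => ?_
    have hi := diverg_integrable hφ.1 hφ.2.1
    obtain ⟨B, hB⟩ := (diverg_continuous hφ.1).bounded_above_of_compact_support (diverg_compact hφ.2.1)
    have hB0 : 0 ≤ B := (norm_nonneg _).trans (hB 0)
    have hnorm : ∀ j, ∫ x, ‖(W j).indicator (diverg φ) x‖ ≤ B * volume.real (W j) := by
      intro j
      have hWj : volume (W j) ≠ ⊤ := ((hk1 j).trans ENNReal.coe_lt_top).ne
      calc _ ≤ ∫ x, (W j).indicator (fun _ => B) x := by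
            refine integral_mono (hi.indicator (hWm j)).norm
              ((integrable_indicator_iff (hWm j)).2 (integrableOn_const hWj)) fun x => ?_
            by_cases hx : x ∈ W j <;> simp [hx, ← Real.norm_eq_abs, hB]
        _ = _ := by
            rw [integral_indicator (hWm j), setIntegral_const, smul_eq_mul, mul_comm]
    have hs : HasSum (fun j => ∫ x, (W j).indicator (diverg φ) x)
        (∫ x, ∑' j, (W j).indicator (diverg φ) x) := by
      refine hasSum_integral_of_summable_integral_norm (fun j => hi.indicator (hWm j)) ?_
      refine Summable.of_nonneg_of_le (fun j => integral_nonneg fun _ => norm_nonneg _) hnorm ?_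
      exact (ENNReal.summable_toReal hvol).mul_left B
    have heq : ∫ x in Ω, (v x).toReal * diverg φ x = ∫ x, ∑' j, (W j).indicator (diverg φ) x := by
      rw [setIntegral_eq_integral_of_forall_compl_eq_zero fun x hx => by
        rw [diverg_zero fun h => hx (hφ.2.2.1 h), mul_zero]]
      refine integral_congr_ae (Eventually.of_forall fun x => ?_)
      show (v x).toReal * _ = _
      rw [ENNReal.tsum_toReal_eq fun j => by by_cases hx : x ∈ W j <;> simp [hx], ← tsum_mul_right]
      refine tsum_congr fun j => ?_
      by_cases hx : x ∈ W j <;> simp [hx]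
    rw [heq]
    refine le_of_tendsto (ENNReal.tendsto_ofReal hs) (Eventually.of_forall fun F => ?_)
    calc ENNReal.ofReal (∑ j ∈ F, ∫ x, (W j).indicator (diverg φ) x) ≤
        ∑ j ∈ F, ENNReal.ofReal (∫ x, (W j).indicator (diverg φ) x) := by
          exact Finset.le_sum_of_subadditive ENNReal.ofReal ENNReal.ofReal_zero.le
            (fun x y => ENNReal.ofReal_add_le) _ _
      _ ≤ ∑ j ∈ F, (e j : ℝ≥0∞) := by
        refine Finset.sum_le_sum fun j _ => le_trans ?_ (hk2 j).le
        rw [integral_indicator (hWm j)]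
        exact le_iSup₂_of_le (f := fun φ (_ : φ ∈ TestVF Ω) => ENNReal.ofReal (∫ x in W j, diverg φ x))
          φ hφ le_rfl
      _ ≤ 1 := (ENNReal.sum_le_tsum _).trans hes.le
  ·
    refine sInf_eq_top.2 ?_
    rintro _ ⟨s, rfl, hs⟩
    exfalso
    have : Tendsto (fun _ : ℝ => (1:ℝ≥0∞)) (𝓝[>] (0:ℝ)) (𝓝 (ENNReal.ofReal 0)) := by
      refine hs.congr' ?_
      filter_upwards [hbig x hx s, self_mem_nhdsWithin] with ρ h0 hρ
      have hvb : volume (ball x ρ) ≠ 0 := (measure_ball_pos volume x hρ).ne'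
      have : volume ({y | y ∈ Ω ∧ s < (v y).toReal} ∩ ball x ρ) = volume (ball x ρ) := by
        refine le_antisymm (measure_mono inter_subset_right) ?_
        have := measure_le_inter_add_sdiff volume (ball x ρ) {y | y ∈ Ω ∧ s < (v y).toReal}
        rwa [h0, add_zero, inter_comm] at this
      rw [this, ENNReal.div_self hvb measure_ball_lt_top.ne]
    simpa using tendsto_nhds_unique this tendsto_const_nhds
  · refine sSup_eq_top.2 fun b hb => ?_
    obtain ⟨s, hs⟩ := EReal.lt_iff_exists_real_btwn.1 hb
    refine ⟨s, ⟨s, rfl, ?_⟩, hs.1⟩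
    rw [HasDensity, ENNReal.ofReal_zero]
    refine (tendsto_const_nhds (x := (0:ℝ≥0∞))).congr' ?_
    filter_upwards [hbig x hx s] with ρ h0
    have : volume ({y | y ∈ Ω ∧ (v y).toReal < s} ∩ ball x ρ) = 0 :=
      measure_mono_null (t := ball x ρ \ {y | y ∈ Ω ∧ s < (v y).toReal})
        (fun y hy => ⟨hy.2, fun h => lt_asymm h.2 hy.1.2⟩) h0
    rw [this, ENNReal.zero_div]

open scoped Manifold ContDiff in
lemma bump_compact {K O : Set (Euc N)} (hK : IsCompact K) (hO : IsOpen O) (hKO : K ⊆ O) :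
    ∃ f : Euc N → ℝ, ContDiff ℝ 1 f ∧ HasCompactSupport f ∧ tsupport f ⊆ O ∧
      (∀ x, 0 ≤ f x ∧ f x ≤ 1) ∧ ∀ x ∈ K, f x = 1 := by
  obtain ⟨δ1, h1, h1'⟩ := hK.exists_cthickening_subset_open hO hKO
  set δ := δ1 with hδ
  obtain ⟨f, hf, hr, hs, hone⟩ := exists_contMDiff_support_eq_eq_one_iff (n := 1) 𝓘(ℝ, Euc N)
    (isOpen_thickening (δ := δ) (E := K)) hK.isClosed (self_subset_thickening h1 K)
  have hts : tsupport f ⊆ cthickening δ K := by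
    rw [tsupport, hs]; exact closure_thickening_subset_cthickening _ _
  refine ⟨f, contMDiff_iff_contDiff.1 hf, ?_, hts.trans h1', fun x => hr ⟨x, rfl⟩, fun x hx => (hone x).1 hx⟩
  exact hK.cthickening.of_isClosed_subset (isClosed_tsupport _) hts

lemma dual_bound {g : Euc N → ℝ} (hg : Integrable g) (hm : Measurable g) {O : Set (Euc N)} (hO : IsOpen O)
    {K : ℝ} (h : ∀ ψ : Euc N → ℝ, ContDiff ℝ 1 ψ → HasCompactSupport ψ → tsupport ψ ⊆ O →
      (∀ x, |ψ x| ≤ 1) → ∫ x, g x * ψ x ≤ K) : ∫⁻ x in O, ‖g x‖ₑ ≤ ENNReal.ofReal K := by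
  have hgO : IntegrableOn (fun x => |g x|) O := hg.abs.integrableOn
  have key : ∫ x in O, |g x| ≤ K := by
    refine le_of_forall_pos_le_add fun ε' hε' => ?_
    set ε := ε' / 4 with hε
    have hε0 : 0 < ε := by positivity
    let ν : Measure (Euc N) := volume.withDensity (fun x => ‖g x‖ₑ)
    have hfin : IsFiniteMeasure ν := isFiniteMeasure_withDensity hg.2.ne
    have hP : MeasurableSet (O ∩ {x | 0 < g x}) := hO.measurableSet.inter (measurableSet_lt measurable_const hm)
    have hQ : MeasurableSet (O ∩ {x | g x < 0}) := hO.measurableSet.inter (measurableSet_lt hm measurable_const)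
    obtain ⟨K1, hK1s, hK1, hK1v⟩ := hP.exists_isCompact_sdiff_lt (μ := ν) (measure_ne_top _ _)
      (ε := ENNReal.ofReal ε) (by simpa using hε0)
    obtain ⟨K2, hK2s, hK2, hK2v⟩ := hQ.exists_isCompact_sdiff_lt (μ := ν) (measure_ne_top _ _)
      (ε := ENNReal.ofReal ε) (by simpa using hε0)
    set P := (O ∩ {x | 0 < g x}) \ K1 with hPd
    set Q := (O ∩ {x | g x < 0}) \ K2 with hQd
    have hPm : MeasurableSet P := hP.diff hK1.measurableSet
    have hQm : MeasurableSet Q := hQ.diff hK2.measurableSet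
    have conv : ∀ S, MeasurableSet S → ν S < ENNReal.ofReal ε → ∫ x in S, |g x| ≤ ε := by
      intro S hS hlt
      rw [withDensity_apply _ hS] at hlt
      rw [integral_eq_lintegral_of_nonneg_ae (ae_of_all _ fun x => abs_nonneg _) (by fun_prop)]
      refine ENNReal.toReal_le_of_le_ofReal hε0.le ?_
      refine le_trans (le_of_eq ?_) hlt.le
      refine lintegral_congr fun x => ?_
      rw [← Real.norm_eq_abs, ofReal_norm]
    have c1 := conv P hPm hK1v
    have c2 := conv Q hQm hK2v
    have hd12 : ∀ x, x ∈ K1 → x ∉ K2 := fun x h1 h2 => by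
      have a : 0 < g x := (hK1s h1).2
      have b : g x < 0 := (hK2s h2).2
      exact lt_asymm a b
    obtain ⟨f1, f1c, f1s, f1t, f1b, f1o⟩ := bump_compact hK1 (hO.sdiff hK2.isClosed)
      (fun x hx => ⟨(hK1s hx).1, hd12 x hx⟩)
    obtain ⟨f2, f2c, f2s, f2t, f2b, f2o⟩ := bump_compact hK2 (hO.sdiff hK1.isClosed)
      (fun x hx => ⟨(hK2s hx).1, fun h' => hd12 x h' hx⟩)
    have z1 : ∀ x, (x ∉ O ∨ x ∈ K2) → f1 x = 0 := fun x hx => by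
      by_contra hne
      have := f1t (subset_tsupport _ hne)
      rcases hx with hx | hx
      · exact hx this.1
      · exact this.2 hx
    have z2 : ∀ x, (x ∉ O ∨ x ∈ K1) → f2 x = 0 := fun x hx => by
      by_contra hne
      have := f2t (subset_tsupport _ hne)
      rcases hx with hx | hx
      · exact hx this.1
      · exact this.2 hx
    have hψb : ∀ x, |f1 x - f2 x| ≤ 1 := fun x => by
      have := f1b x; have := f2b x; rw [abs_le]; constructor <;> linarith
    have hh := h (fun x => f1 x - f2 x) (f1c.sub f2c) (f1s.sub f2s)
      ((tsupport_sub _ _).trans (union_subset (f1t.trans sdiff_subset) (f2t.trans sdiff_subset))) hψb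
    have hψc : Continuous (fun x => f1 x - f2 x) := f1c.continuous.sub f2c.continuous
    have hinteg : Integrable (fun x => g x * (f1 x - f2 x)) := by
      refine hg.mono (hm.aestronglyMeasurable.mul hψc.aestronglyMeasurable) (ae_of_all _ fun x => ?_)
      rw [norm_mul]
      calc _ ≤ ‖g x‖ * 1 := by gcongr; exact hψb x
        _ = _ := mul_one _
    have hpt : ∀ x, O.indicator (fun x => |g x|) x ≤ g x * (f1 x - f2 x) + 2 * P.indicator (fun x => |g x|) x
        + 2 * Q.indicator (fun x => |g x|) x := by
      intro x
      by_cases hxO : x ∈ O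
      · rw [indicator_of_mem hxO]
        have hb := abs_le.1 (hψb x)
        have habs : -|g x| ≤ g x * (f1 x - f2 x) := by
          have : |g x * (f1 x - f2 x)| ≤ |g x| := by
            rw [abs_mul]; exact mul_le_of_le_one_right (abs_nonneg _) (hψb x)
          linarith [(abs_le.1 this).1]
        have hPi : 0 ≤ P.indicator (fun x => |g x|) x := indicator_nonneg (fun _ _ => abs_nonneg _) _
        have hQi : 0 ≤ Q.indicator (fun x => |g x|) x := indicator_nonneg (fun _ _ => abs_nonneg _) _
        rcases lt_trichotomy (g x) 0 with hlt | heq | hgt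
        · by_cases hx2 : x ∈ K2
          · rw [z1 x (Or.inr hx2), f2o x hx2, abs_of_neg hlt]; linarith
          · have : x ∈ Q := ⟨⟨hxO, hlt⟩, hx2⟩
            rw [indicator_of_mem this]; linarith
        · rw [heq] at *; simp at *; linarith
        · by_cases hx1 : x ∈ K1
          · rw [z2 x (Or.inr hx1), f1o x hx1, abs_of_pos hgt]; linarith
          · have : x ∈ P := ⟨⟨hxO, hgt⟩, hx1⟩
            rw [indicator_of_mem this]; linarith
      · have h1 : x ∉ P := fun h => hxO h.1.1
        have h2 : x ∉ Q := fun h => hxO h.1.1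
        rw [indicator_of_notMem hxO, indicator_of_notMem h1, indicator_of_notMem h2, z1 x (Or.inl hxO), z2 x (Or.inl hxO)]
        simp
    have hiP : Integrable (P.indicator (fun x => |g x|)) := hg.abs.indicator hPm
    have hiQ : Integrable (Q.indicator (fun x => |g x|)) := hg.abs.indicator hQm
    have hi1 : Integrable (fun x => g x * (f1 x - f2 x) + 2 * P.indicator (fun x => |g x|) x) :=
      hinteg.add (hiP.const_mul 2)
    have := integral_mono (hg.abs.indicator hO.measurableSet)
      (hi1.add (hiQ.const_mul 2)) hpt
    simp only [Pi.add_apply] at this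
    rw [integral_add hi1 (hiQ.const_mul 2), integral_add hinteg (hiP.const_mul 2),
      integral_const_mul, integral_const_mul, integral_indicator hO.measurableSet, integral_indicator hPm,
      integral_indicator hQm] at this
    linarith
  have e : ∫⁻ x in O, ‖g x‖ₑ = ENNReal.ofReal (∫ x in O, |g x|) := by
    rw [ofReal_integral_eq_lintegral_ofReal hgO (ae_of_all _ fun x => abs_nonneg _)]
    refine lintegral_congr fun x => ?_
    rw [← Real.norm_eq_abs, ofReal_norm]
  rw [e]; exact ENNReal.ofReal_le_ofReal key

lemma diverg_smul_const {θ : Euc N → ℝ} (w x : Euc N) (hθ : DifferentiableAt ℝ θ x) :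
    diverg (fun y => θ y • w) x = fderiv ℝ θ x w := by
  unfold diverg
  rw [fderiv_smul_const hθ]
  have : w = ∑ i, w i • EuclideanSpace.single i (1:ℝ) := by
    have := (EuclideanSpace.basisFun (Fin N) ℝ).sum_repr w
    simpa using this.symm
  conv_rhs => rw [this]
  rw [map_sum]
  refine Finset.sum_congr rfl fun i _ => ?_
  simp [mul_comm]

lemma test_le {u : Euc N → ℝ} {Ω : Set (Euc N)} (hz : ∀ x, x ∉ Ω → u x = 0)
    (hV : variation u Ω ≠ ⊤) {φ : Euc N → Euc N} (hφ : φ ∈ TestVF Ω) :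
    ∫ x, u x * diverg φ x ≤ (variation u Ω).toReal := by
  have h1 : ENNReal.ofReal (∫ x in Ω, u x * diverg φ x) ≤ variation u Ω :=
    le_iSup₂ (f := fun φ (_ : φ ∈ TestVF Ω) => ENNReal.ofReal (∫ x in Ω, u x * diverg φ x)) φ hφ
  rw [setIntegral_eq_integral_of_forall_compl_eq_zero (fun x hx => by rw [hz x hx, zero_mul])] at h1
  exact (ENNReal.ofReal_le_iff_le_toReal hV).1 h1

lemma diff_bound {u : Euc N → ℝ} (hu : Integrable u) (hm : Measurable u) {Ω : Set (Euc N)}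
    (hz : ∀ x, x ∉ Ω → u x = 0) (hV : variation u Ω ≠ ⊤) {δ : ℝ} {h : Euc N} (hh : ‖h‖ ≤ δ) :
    ∫⁻ x in (cthickening δ Ωᶜ)ᶜ, ‖u (x + h) - u x‖ₑ ≤ ENNReal.ofReal (‖h‖ * (variation u Ω).toReal) := by
  rcases eq_or_ne h 0 with rfl | hne
  · simp
  have hpos : 0 < ‖h‖ := norm_pos_iff.2 hne
  have huh : Integrable (fun x => u (x + h)) := hu.comp_add_right h
  refine dual_bound (g := fun x => u (x + h) - u x) (huh.sub hu) (by fun_prop)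
    isClosed_cthickening.isOpen_compl ?_
  intro ψ hψ hc hs hb
  set V := (variation u Ω).toReal
  obtain ⟨D, hD⟩ : ∃ D, ∀ x, ‖fderiv ℝ ψ x‖ ≤ D :=
    (hc.fderiv (𝕜 := ℝ)).exists_bound_of_continuous (hψ.continuous_fderiv one_ne_zero)
  have hD0 : 0 ≤ D := (norm_nonneg _).trans (hD 0)
  have hfc : Continuous (fderiv ℝ ψ) := hψ.continuous_fderiv one_ne_zero
  let F : ℝ → ℝ := fun τ => ∫ x, u x * ψ (x - τ • h)
  let F' : ℝ → ℝ := fun τ => ∫ x, u x * fderiv ℝ ψ (x - τ • h) (-h)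
  have hinteg : ∀ τ : ℝ, Integrable (fun x => u x * ψ (x - τ • h)) := fun τ => by
    refine hu.mono (hm.aestronglyMeasurable.mul ?_) (ae_of_all _ fun x => ?_)
    · exact (hψ.continuous.comp (continuous_id.sub continuous_const)).aestronglyMeasurable
    · rw [norm_mul]
      exact mul_le_of_le_one_right (norm_nonneg _) (hb _)
  have hdψ : ∀ x : Euc N, ∀ τ : ℝ, HasDerivAt (fun τ : ℝ => ψ (x - τ • h)) (fderiv ℝ ψ (x - τ • h) (-h)) τ := by
    intro x τ
    have h1 : HasDerivAt (fun τ : ℝ => x - τ • h) (-h) τ := by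
      have := ((hasDerivAt_id τ).smul_const h).const_sub x
      simpa using this
    exact ((hψ.differentiable one_ne_zero) (x - τ • h)).hasFDerivAt.comp_hasDerivAt τ h1
  have hder : ∀ τ, HasDerivAt F (F' τ) τ := by
    intro τ
    refine (hasDerivAt_integral_of_dominated_loc_of_deriv_le (μ := volume) (F := fun τ x => u x * ψ (x - τ • h))
      (F' := fun τ x => u x * fderiv ℝ ψ (x - τ • h) (-h)) (x₀ := τ) (s := univ) (bound := fun x => |u x| * (D * ‖h‖))
      univ_mem (Eventually.of_forall fun τ => (hinteg τ).1) (hinteg τ) ?_ ?_ ?_ ?_).2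
    · refine hm.aestronglyMeasurable.mul ?_
      have : Continuous fun x : Euc N => fderiv ℝ ψ (x - τ • h) (-h) := by fun_prop
      exact this.aestronglyMeasurable
    · refine ae_of_all _ fun x τ _ => ?_
      rw [norm_mul, Real.norm_eq_abs]
      gcongr
      calc _ ≤ ‖fderiv ℝ ψ (x - τ • h)‖ * ‖-h‖ := ContinuousLinearMap.le_opNorm _ _
        _ ≤ _ := by rw [norm_neg]; gcongr; exact hD _
    · exact hu.abs.mul_const _
    · exact ae_of_all _ fun x τ _ => (hdψ x τ).const_mul (u x)
  have hle : ∀ τ ∈ Icc (0:ℝ) 1, F' τ ≤ ‖h‖ * V := by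
    intro τ hτ
    set w : Euc N := ‖h‖⁻¹ • (-h) with hw
    have hwn : ‖w‖ = 1 := by
      rw [hw, norm_smul, norm_neg, norm_inv, norm_norm, inv_mul_cancel₀ hpos.ne']
    let φ : Euc N → Euc N := fun x => ψ (x - τ • h) • w
    have hθ : ContDiff ℝ 1 (fun x : Euc N => ψ (x - τ • h)) := hψ.comp (contDiff_id.sub contDiff_const)
    have hφ : φ ∈ TestVF Ω := by
      refine ⟨hθ.smul contDiff_const, ?_, ?_, fun x => ?_⟩
      · have : HasCompactSupport (fun x : Euc N => ψ (x - τ • h)) :=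
          hc.comp_homeomorph (Homeomorph.subRight (τ • h))
        exact this.smul_right
      · have hcl : IsClosed {x : Euc N | x - τ • h ∈ tsupport ψ} :=
          (isClosed_tsupport ψ).preimage (continuous_id.sub continuous_const)
        have : tsupport φ ⊆ {x : Euc N | x - τ • h ∈ tsupport ψ} := by
          refine closure_minimal (fun x hx => ?_) hcl
          refine subset_tsupport _ fun h0 => hx ?_
          change ψ (x - τ • h) • w = 0
          rw [h0, zero_smul]
        intro x hx
        by_contra hxΩ
        refine hs (this hx) (mem_cthickening_of_dist_le _ x δ _ hxΩ ?_)
        rw [dist_eq_norm, sub_sub_cancel_left, norm_neg, norm_smul, Real.norm_eq_abs, abs_of_nonneg hτ.1]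
        calc τ * ‖h‖ ≤ 1 * ‖h‖ := by gcongr; exact hτ.2
          _ ≤ δ := by rwa [one_mul]
      · change ‖ψ (x - τ • h) • w‖ ≤ 1
        rw [norm_smul, hwn, mul_one]; exact hb _
    have ht := test_le hz hV hφ
    have hdv : ∀ x, diverg φ x = ‖h‖⁻¹ * fderiv ℝ ψ (x - τ • h) (-h) := by
      intro x
      rw [diverg_smul_const w x ((hθ.differentiable one_ne_zero) x), fderiv_comp_sub, hw, map_smul, smul_eq_mul]
    have e : ∫ x, u x * diverg φ x = ‖h‖⁻¹ * F' τ := by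
      rw [← integral_const_mul]
      refine integral_congr_ae (ae_of_all _ fun x => ?_)
      simp only [hdv]; ring
    rw [e] at ht
    calc F' τ = ‖h‖ * (‖h‖⁻¹ * F' τ) := by field_simp
      _ ≤ _ := by gcongr
  have hmv : F 1 - F 0 ≤ ‖h‖ * V * (1 - 0) := by
    refine Convex.image_sub_le_mul_sub_of_deriv_le (convex_Icc (0:ℝ) 1)
      (fun τ _ => (hder τ).continuousAt.continuousWithinAt)
      (fun τ _ => (hder τ).differentiableAt.differentiableWithinAt) ?_ 0 (by simp) 1 (by simp) zero_le_one
    intro τ hτ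
    rw [(hder τ).deriv]
    exact hle τ (interior_subset hτ)
  have e1 : F 1 = ∫ x, u (x + h) * ψ x := by
    change ∫ x, u x * ψ (x - (1:ℝ) • h) = _
    rw [← integral_add_right_eq_self (fun x => u x * ψ (x - (1:ℝ) • h)) h]
    simp
  have e0 : F 0 = ∫ x, u x * ψ x := by
    change ∫ x, u x * ψ (x - (0:ℝ) • h) = _
    simp
  have hi1 : Integrable (fun x => u (x + h) * ψ x) := by
    have := (hinteg 1).comp_add_right h
    simpa using this
  have hi0 : Integrable (fun x => u x * ψ x) := by simpa using hinteg 0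
  have : ∫ x, (u (x + h) - u x) * ψ x = F 1 - F 0 := by
    rw [e1, e0, ← integral_sub hi1 hi0]
    refine integral_congr_ae (ae_of_all _ fun x => ?_)
    simp only; ring
  rw [this]; linarith

/-- Points `x` such that exactly one of `x`, `x + h` lies in `E`. -/
def Sh (E : Set (Euc N)) (h : Euc N) : Set (Euc N) := {x | ¬ (x ∈ E ↔ x + h ∈ E)}

/-- Nonlocal difference energy. -/
def Kf (ε : ℝ) (E A : Set (Euc N)) : ℝ≥0∞ := ∫⁻ h in ball (0 : Euc N) ε, volume (A ∩ Sh E h)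

lemma measurableSet_Sh_prod {E : Set (Euc N)} (hE : MeasurableSet E) :
    MeasurableSet {p : Euc N × Euc N | p.2 ∈ Sh E p.1} := by
  have h1 : MeasurableSet {p : Euc N × Euc N | p.2 ∈ E} := measurable_snd hE
  have h2 : MeasurableSet {p : Euc N × Euc N | p.2 + p.1 ∈ E} :=
    (measurable_snd.add measurable_fst) hE
  exact (MeasurableSet.iff h1 h2).compl

lemma measurableSet_Sh {E : Set (Euc N)} (hE : MeasurableSet E) (h : Euc N) : MeasurableSet (Sh E h) :=
  measurable_prodMk_left (x := h) (measurableSet_Sh_prod hE)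

lemma measurable_Sh {E A : Set (Euc N)} (hE : MeasurableSet E) (hA : MeasurableSet A) :
    Measurable fun h => volume (A ∩ Sh E h) := by
  have : MeasurableSet {p : Euc N × Euc N | p.2 ∈ A ∩ Sh E p.1} :=
    (measurable_snd hA).inter (measurableSet_Sh_prod hE)
  exact measurable_measure_prodMk_left this

lemma level_measure (a b : ℝ) : volume {t : ℝ | ¬ (t < a ↔ t < b)} = ‖b - a‖ₑ := by
  have : {t : ℝ | ¬ (t < a ↔ t < b)} = Ico (min a b) (max a b) := by
    ext t
    simp only [mem_ofPred_eq, mem_Ico, min_le_iff, lt_max_iff]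
    constructor
    · intro h
      by_cases h1 : t < a <;> by_cases h2 : t < b <;> simp_all
    · rintro ⟨h1, h2⟩ h3
      by_cases h4 : t < a
      · have := h3.1 h4
        rcases h1 with h1 | h1 <;> linarith
      · have h5 : ¬ t < b := fun h => h4 (h3.2 h)
        rcases h2 with h2 | h2 <;> contradiction
  rw [this, Real.volume_Ico, max_sub_min_eq_abs, ← Real.norm_eq_abs, ofReal_norm]

def Tset (u : Euc N → ℝ) : Set ((ℝ × Euc N) × Euc N) :=
  {p | ¬ (p.1.1 < u p.2 ↔ p.1.1 < u (p.2 + p.1.2))}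

lemma Tset_meas {u : Euc N → ℝ} (hm : Measurable u) : MeasurableSet (Tset u) := by
  refine MeasurableSet.compl (MeasurableSet.iff ?_ ?_)
  · exact measurableSet_lt (by fun_prop) (by fun_prop)
  · exact measurableSet_lt (by fun_prop) (by fun_prop)

lemma vol_eq {u : Euc N → ℝ} (hm : Measurable u) {A : Set (Euc N)} (t : ℝ) (h : Euc N) :
    volume (A ∩ Sh {y | t < u y} h) = ∫⁻ x in A, (Tset u).indicator 1 ((t, h), x) := by
  have hE : MeasurableSet {y | t < u y} := measurableSet_lt measurable_const hm
  rw [inter_comm, ← Measure.restrict_apply (measurableSet_Sh hE h), ← lintegral_indicator_one (measurableSet_Sh hE h)]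
  rfl

lemma meas_vol {u : Euc N → ℝ} (hm : Measurable u) {A : Set (Euc N)} :
    Measurable fun p : ℝ × Euc N => volume (A ∩ Sh {y | p.1 < u y} p.2) := by
  simp_rw [vol_eq hm]
  exact Measurable.lintegral_prod_right' (f := (Tset u).indicator 1) (measurable_one.indicator (Tset_meas hm))

lemma meas_Kf {u : Euc N → ℝ} (hm : Measurable u) {A : Set (Euc N)} (ε : ℝ) :
    Measurable fun t : ℝ => Kf ε {y | t < u y} A :=
  Measurable.lintegral_prod_right' (f := fun p : ℝ × Euc N => volume (A ∩ Sh {y | p.1 < u y} p.2)) (meas_vol hm)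

lemma coarea_diff {u : Euc N → ℝ} (hu : Integrable u) (hm : Measurable u) {Ω : Set (Euc N)}
    (hz : ∀ x, x ∉ Ω → u x = 0) (hV : variation u Ω ≠ ⊤) {δ ε : ℝ} (hε : ε ≤ δ) :
    ∫⁻ t : ℝ, Kf ε {y | t < u y} (cthickening δ Ωᶜ)ᶜ ≤
      ENNReal.ofReal (ε * (variation u Ω).toReal) * volume (ball (0 : Euc N) ε) := by
  set A := (cthickening δ Ωᶜ)ᶜ
  unfold Kf
  rw [lintegral_lintegral_swap (f := fun (t : ℝ) (h : Euc N) => volume (A ∩ Sh {y | t < u y} h)) (meas_vol hm).aemeasurable]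
  rw [← setLIntegral_const]
  refine setLIntegral_mono measurable_const fun h hh => ?_
  have hhε : ‖h‖ < ε := by simpa using hh
  simp_rw [vol_eq hm]
  rw [lintegral_lintegral_swap (f := fun (t : ℝ) (x : Euc N) => (Tset u).indicator 1 ((t, h), x))]
  · have e : ∀ x, ∫⁻ t : ℝ, (Tset u).indicator (1 : (ℝ × Euc N) × Euc N → ℝ≥0∞) ((t, h), x) = ‖u (x + h) - u x‖ₑ := by
      intro x
      rw [← level_measure, ← lintegral_indicator_one]
      · rfl
      · refine MeasurableSet.compl (MeasurableSet.iff ?_ ?_)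
        · exact measurableSet_lt (by fun_prop) (by fun_prop)
        · exact measurableSet_lt (by fun_prop) (by fun_prop)
    simp_rw [e]
    refine (diff_bound hu hm hz hV (hhε.le.trans hε)).trans ?_
    gcongr
  · have : Measurable fun p : ℝ × Euc N => (Tset u).indicator (1 : (ℝ × Euc N) × Euc N → ℝ≥0∞) ((p.1, h), p.2) :=
      (measurable_one.indicator (Tset_meas hm)).comp (by fun_prop)
    exact this.aemeasurable

lemma good_level {u : Euc N → ℝ} (hu : Integrable u) (hm : Measurable u) {Ω : Set (Euc N)}
    (hz : ∀ x, x ∉ Ω → u x = 0) (hV : variation u Ω ≠ ⊤) {δ : ℝ} (hδ : 0 < δ) (T : ℝ) {η : ℝ≥0∞} (hη : 0 < η) :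
    ∃ t > T, ∃ᶠ n : ℕ in atTop, Kf (δ / (n + 1)) {y | t < u y} (cthickening δ Ωᶜ)ᶜ ≤
      η * (ENNReal.ofReal (δ / (n + 1)) * volume (ball (0 : Euc N) (δ / (n + 1)))) := by
  set A := (cthickening δ Ωᶜ)ᶜ
  set ε : ℕ → ℝ := fun n => δ / (n + 1) with hεd
  have hε0 : ∀ n, 0 < ε n := fun n => by positivity
  have hεδ : ∀ n, ε n ≤ δ := fun n => div_le_self hδ.le (by linarith [(Nat.cast_nonneg n : (0:ℝ) ≤ n)])
  set X : ℕ → ℝ≥0∞ := fun n => ENNReal.ofReal (ε n) * volume (ball (0 : Euc N) (ε n)) with hX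
  have hX0 : ∀ n, X n ≠ 0 := fun n => mul_ne_zero (by simpa using hε0 n) (measure_ball_pos _ _ (hε0 n)).ne'
  have hXt : ∀ n, X n ≠ ⊤ := fun n => ENNReal.mul_ne_top ENNReal.ofReal_ne_top measure_ball_lt_top.ne
  let G : ℕ → ℝ → ℝ≥0∞ := fun n t => Kf (ε n) {y | t < u y} A / X n
  have hG : ∀ n, ∫⁻ t, G n t ≤ variation u Ω := by
    intro n
    simp only [G, div_eq_mul_inv]
    rw [lintegral_mul_const _ (meas_Kf hm _), ← div_eq_mul_inv]
    refine ENNReal.div_le_of_le_mul ?_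
    refine (coarea_diff hu hm hz hV (hεδ n)).trans (le_of_eq ?_)
    rw [ENNReal.ofReal_mul (hε0 n).le, ENNReal.ofReal_toReal hV]
    simp only [hX]; ring
  by_contra hcon
  push Not at hcon
  have hlim : ∀ t > T, η ≤ liminf (fun n => G n t) atTop := by
    intro t ht
    have := hcon t ht
    refine le_liminf_of_le (by isBoundedDefault) ?_
    filter_upwards [this] with n hn
    rw [ENNReal.le_div_iff_mul_le (Or.inl (hX0 n)) (Or.inl (hXt n))]
    exact hn.le
  have h1 : ∫⁻ t, liminf (fun n => G n t) atTop ≤ liminf (fun n => ∫⁻ t, G n t) atTop :=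
    lintegral_liminf_le fun n => (meas_Kf hm _).div_const _
  have h2 : liminf (fun n => ∫⁻ t, G n t) atTop ≤ variation u Ω :=
    (liminf_le_liminf (Eventually.of_forall hG)).trans (by simp)
  have h3 : ∫⁻ t in Ioi T, η ≤ ∫⁻ t, liminf (fun n => G n t) atTop :=
    (setLIntegral_mono' measurableSet_Ioi fun t ht => hlim t ht).trans (setLIntegral_le_lintegral _ _)
  rw [setLIntegral_const, Real.volume_Ioi, ENNReal.mul_top hη.ne'] at h3
  exact hV (top_le_iff.1 (h3.trans (h1.trans h2)))

lemma tele {E : Set (Euc N)} (hE : MeasurableSet E) (c : Euc N) (ρ : ℝ) (h : Euc N) (m : ℕ) (hm : 1 ≤ m) :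
    volume {x | x ∈ E ∩ ball c ρ ∧ x + h ∈ ball c ρ \ E} ≤
      m * volume (ball c ρ ∩ Sh E ((m : ℝ)⁻¹ • h)) := by
  have hm0 : (0:ℝ) < m := by exact_mod_cast hm
  set k := (m : ℝ)⁻¹ • h with hk
  have hsub : {x | x ∈ E ∩ ball c ρ ∧ x + h ∈ ball c ρ \ E} ⊆
      ⋃ j ∈ Finset.range m, (fun x => x + (j : ℝ) • k) ⁻¹' (ball c ρ ∩ Sh E k) := by
    rintro x ⟨⟨hxE, hxB⟩, hyB, hyE⟩
    have hmk : (m : ℝ) • k = h := by rw [hk, smul_inv_smul₀ hm0.ne']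
    have hex : ∃ j < m, x + (j : ℝ) • k ∈ E ∧ x + ((j + 1 : ℕ) : ℝ) • k ∉ E := by
      by_contra hcon
      push Not at hcon
      have : ∀ j ≤ m, x + (j : ℝ) • k ∈ E := by
        intro j
        induction j with
        | zero => intro _; simpa using hxE
        | succ j ih => intro hj; exact hcon j (by omega) (ih (by omega))
      have := this m le_rfl
      rw [hmk] at this
      exact hyE this
    obtain ⟨j, hj, h1, h2⟩ := hex
    refine mem_biUnion (Finset.mem_coe.2 (Finset.mem_range.2 hj)) ⟨?_, ?_⟩
    · have hc := (convex_ball c ρ).add_smul_mem hxB hyB (t := (j : ℝ) * (m : ℝ)⁻¹)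
        ⟨by positivity, by
          rw [← div_eq_mul_inv, div_le_one hm0]; exact_mod_cast hj.le⟩
      rw [mul_smul] at hc
      exact hc
    · have h3 : x + (j : ℝ) • k + k ∉ E := by
        have : x + (j : ℝ) • k + k = x + ((j + 1 : ℕ) : ℝ) • k := by
          push_cast; rw [add_smul, one_smul, add_assoc]
        rwa [this]
      exact fun h => h3 (h.1 h1)
  refine (measure_mono hsub).trans ((measure_biUnion_finset_le _ _).trans (le_of_eq ?_))
  simp only [measure_preimage_add_right, Finset.sum_const, Finset.card_range, nsmul_eq_mul]

lemma iso_raw {E : Set (Euc N)} (hE : MeasurableSet E) (c : Euc N) {ρ ε : ℝ} (m : ℕ) (hm : 1 ≤ m)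
    (hmε : 2 * ρ ≤ m * ε) :
    volume (E ∩ ball c ρ) * volume (ball c ρ \ E) ≤ (m : ℝ≥0∞) ^ (N + 1) * Kf ε E (ball c ρ) := by
  have hm0 : (0:ℝ) < m := by exact_mod_cast hm
  set B := ball c ρ with hB
  have hBm : MeasurableSet B := measurableSet_ball
  have hP : MeasurableSet (E ∩ B) := hE.inter hBm
  have hQ : MeasurableSet (B \ E) := hBm.diff hE
  have hW : MeasurableSet {p : Euc N × Euc N | p.2 ∈ E ∩ B ∧ p.2 + p.1 ∈ B \ E} :=
    (measurable_snd hP).inter ((measurable_snd.add measurable_fst) hQ)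
  let f : Euc N → ℝ≥0∞ := (ball (0 : Euc N) ε).indicator fun h => volume (B ∩ Sh E h)
  have hf : Measurable f := (measurable_Sh hE hBm).indicator measurableSet_ball
  have e1 : volume (E ∩ B) * volume (B \ E) = ∫⁻ h, volume {x | x ∈ E ∩ B ∧ x + h ∈ B \ E} := by
    have s1 : ∀ h, volume {x | x ∈ E ∩ B ∧ x + h ∈ B \ E} =
        ∫⁻ x, {p : Euc N × Euc N | p.2 ∈ E ∩ B ∧ p.2 + p.1 ∈ B \ E}.indicator 1 (h, x) := by
      intro h
      have : MeasurableSet {x | x ∈ E ∩ B ∧ x + h ∈ B \ E} := measurable_prodMk_left (x := h) hW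
      rw [← lintegral_indicator_one this]
      rfl
    simp_rw [s1]
    rw [lintegral_lintegral_swap
      (f := fun h x => {p : Euc N × Euc N | p.2 ∈ E ∩ B ∧ p.2 + p.1 ∈ B \ E}.indicator (1 : Euc N × Euc N → ℝ≥0∞) (h, x))
      (measurable_one.indicator hW).aemeasurable]
    have s2 : ∀ x, ∫⁻ h, {p : Euc N × Euc N | p.2 ∈ E ∩ B ∧ p.2 + p.1 ∈ B \ E}.indicator (1 : Euc N × Euc N → ℝ≥0∞) (h, x)
        = (E ∩ B).indicator (fun _ => volume (B \ E)) x := by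
      intro x
      by_cases hx : x ∈ E ∩ B
      · rw [indicator_of_mem hx]
        have hs : MeasurableSet ((fun h => x + h) ⁻¹' (B \ E)) := (measurable_const_add x) hQ
        rw [← measure_preimage_add volume x (B \ E), ← lintegral_indicator_one hs]
        refine lintegral_congr fun h => ?_
        by_cases hh : x + h ∈ B \ E
        · rw [indicator_of_mem (show (h, x) ∈ {p : Euc N × Euc N | p.2 ∈ E ∩ B ∧ p.2 + p.1 ∈ B \ E} from ⟨hx, hh⟩),
            indicator_of_mem (show h ∈ ((fun h => x + h) ⁻¹' (B \ E)) from hh)]; rfl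
        · rw [indicator_of_notMem (fun hc : (h, x) ∈ {p : Euc N × Euc N | p.2 ∈ E ∩ B ∧ p.2 + p.1 ∈ B \ E} => hh hc.2),
            indicator_of_notMem (fun hc : h ∈ ((fun h => x + h) ⁻¹' (B \ E)) => hh hc)]
      · rw [indicator_of_notMem hx]
        refine (lintegral_congr fun h => ?_).trans lintegral_zero
        exact indicator_of_notMem (fun hc : (h, x) ∈ {p : Euc N × Euc N | p.2 ∈ E ∩ B ∧ p.2 + p.1 ∈ B \ E} => hx hc.1) _
    simp_rw [s2]
    rw [lintegral_indicator hP, setLIntegral_const, mul_comm]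
  have e2 : ∀ h, volume {x | x ∈ E ∩ B ∧ x + h ∈ B \ E} ≤ m * f ((m : ℝ)⁻¹ • h) := by
    intro h
    by_cases hh : (m : ℝ)⁻¹ • h ∈ ball (0 : Euc N) ε
    · simp only [f]
      rw [indicator_of_mem hh]
      exact tele hE c ρ h m hm
    · have : {x | x ∈ E ∩ B ∧ x + h ∈ B \ E} = ∅ := by
        rw [eq_empty_iff_forall_notMem]
        rintro x ⟨⟨_, hxB⟩, hyB, _⟩
        apply hh
        rw [mem_ball_zero_iff, norm_smul, norm_inv, Real.norm_natCast]
        have h1 : dist (x + h) x < ρ + ρ := by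
          have := dist_triangle_right (x + h) x c
          rw [hB, mem_ball] at hxB hyB
          linarith
        rw [dist_self_add_left] at h1
        rw [inv_mul_lt_iff₀ hm0]; linarith
      rw [this, measure_empty]; exact zero_le
  have e3 : ∫⁻ h, f ((m : ℝ)⁻¹ • h) = (m : ℝ≥0∞) ^ N * Kf ε E B := by
    have hmap := Measure.map_addHaar_smul (volume : Measure (Euc N)) (r := (m : ℝ)⁻¹) (inv_ne_zero hm0.ne')
    have : ∫⁻ h, f ((m : ℝ)⁻¹ • h) = ∫⁻ y, f y ∂(Measure.map (fun x : Euc N => (m : ℝ)⁻¹ • x) volume) :=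
      (lintegral_map hf (measurable_const_smul _)).symm
    rw [this, hmap, lintegral_smul_measure]
    have hc : ENNReal.ofReal |(((m : ℝ)⁻¹) ^ Module.finrank ℝ (Euc N))⁻¹| = (m : ℝ≥0∞) ^ N := by
      rw [finrank_euclideanSpace_fin, inv_pow, inv_inv, abs_of_pos (by positivity), ENNReal.ofReal_pow hm0.le,
        ENNReal.ofReal_natCast]
    rw [hc, smul_eq_mul]
    congr 1
    exact lintegral_indicator measurableSet_ball _
  rw [e1]
  calc _ ≤ ∫⁻ h, m * f ((m : ℝ)⁻¹ • h) := lintegral_mono e2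
    _ = m * ∫⁻ h, f ((m : ℝ)⁻¹ • h) := lintegral_const_mul _ (hf.comp (measurable_const_smul _))
    _ = _ := by rw [e3, pow_succ]; ring

lemma iso_final {n : ℕ} {E : Set (Euc (n+1))} (hE : MeasurableSet E) (c : Euc (n+1)) {ρ ε : ℝ} (hε : 0 < ε)
    (hερ : ε ≤ ρ) (h1 : volume (ball c ρ) ≤ 2 ^ (n + 2) * volume (E ∩ ball c ρ))
    (h2 : volume (ball c ρ) ≤ 2 * volume (ball c ρ \ E)) :
    ENNReal.ofReal (ρ ^ n) * (ENNReal.ofReal ε * volume (ball (0 : Euc (n+1)) ε)) * volume (ball (0 : Euc (n+1)) 1)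
      ≤ (2 ^ (n + 3) * 3 ^ (n + 2)) * Kf ε E (ball c ρ) := by
  have hρ : 0 < ρ := hε.trans_le hερ
  set m := ⌈2 * ρ / ε⌉₊ with hmd
  have hm1 : 1 ≤ m := Nat.one_le_ceil_iff.2 (by positivity)
  have hm2 : 2 * ρ / ε ≤ m := Nat.le_ceil _
  have hm3 : (m : ℝ) ≤ 3 * ρ / ε := by
    have := (Nat.ceil_lt_add_one (show 0 ≤ 2 * ρ / ε by positivity)).le
    have h' : 1 ≤ ρ / ε := (one_le_div hε).2 hερ
    calc (m : ℝ) ≤ 2 * ρ / ε + 1 := this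
      _ ≤ 2 * ρ / ε + ρ / ε := by gcongr
      _ = _ := by ring
  have hraw := iso_raw hE c (ρ := ρ) (ε := ε) m hm1 (by rwa [div_le_iff₀ hε] at hm2)
  set ω := volume (ball (0 : Euc (n+1)) 1)
  have hvol : ∀ (x : Euc (n+1)) (r : ℝ), 0 < r → volume (ball x r) = ENNReal.ofReal (r ^ (n+1)) * ω := by
    intro x r hr
    have := Measure.addHaar_ball (volume : Measure (Euc (n+1))) x hr.le
    rwa [finrank_euclideanSpace_fin] at this
  have hmE : (m : ℝ≥0∞) ≤ ENNReal.ofReal (3 * ρ / ε) := by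
    rw [← ENNReal.ofReal_natCast]; exact ENNReal.ofReal_le_ofReal hm3
  have hA : (volume (ball c ρ)) * (volume (ball c ρ)) ≤
      2 ^ (n + 3) * (ENNReal.ofReal (3 * ρ / ε) ^ (n + 2) * Kf ε E (ball c ρ)) := by
    calc _ ≤ (2 ^ (n + 2) * volume (E ∩ ball c ρ)) * (2 * volume (ball c ρ \ E)) := mul_le_mul' h1 h2
      _ = 2 ^ (n + 3) * (volume (E ∩ ball c ρ) * volume (ball c ρ \ E)) := by ring
      _ ≤ 2 ^ (n + 3) * ((m : ℝ≥0∞) ^ (n + 1 + 1) * Kf ε E (ball c ρ)) := by gcongr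
      _ ≤ _ := by gcongr
  rw [hvol c ρ hρ] at hA
  rw [hvol 0 ε hε]
  have hfac : ENNReal.ofReal (ε ^ (n+2) / ρ ^ (n+2)) * (ENNReal.ofReal (ρ ^ (n+1)) * ω * (ENNReal.ofReal (ρ ^ (n+1)) * ω))
      = ENNReal.ofReal (ρ ^ n) * (ENNReal.ofReal ε * (ENNReal.ofReal (ε ^ (n+1)) * ω)) * ω := by
    have : ENNReal.ofReal (ε ^ (n+2) / ρ ^ (n+2)) * (ENNReal.ofReal (ρ ^ (n+1)) * ENNReal.ofReal (ρ ^ (n+1)))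
        = ENNReal.ofReal (ρ ^ n) * (ENNReal.ofReal ε * ENNReal.ofReal (ε ^ (n+1))) := by
      rw [← ENNReal.ofReal_mul (by positivity), ← ENNReal.ofReal_mul (by positivity),
        ← ENNReal.ofReal_mul (by positivity), ← ENNReal.ofReal_mul (by positivity)]
      congr 1
      field_simp
      ring
    calc _ = ENNReal.ofReal (ε ^ (n+2) / ρ ^ (n+2)) * (ENNReal.ofReal (ρ ^ (n+1)) * ENNReal.ofReal (ρ ^ (n+1))) * ω * ω := by ring
      _ = _ := by rw [this]; ring
  have hfac2 : ENNReal.ofReal (ε ^ (n+2) / ρ ^ (n+2)) * ENNReal.ofReal (3 * ρ / ε) ^ (n + 2) = 3 ^ (n + 2) := by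
    rw [← ENNReal.ofReal_pow (by positivity), ← ENNReal.ofReal_mul (by positivity)]
    have : ε ^ (n+2) / ρ ^ (n+2) * (3 * ρ / ε) ^ (n+2) = 3 ^ (n + 2) := by
      rw [div_pow, mul_pow]; field_simp
    rw [this, ENNReal.ofReal_pow (by norm_num)]; norm_num
  rw [← hfac]
  calc _ ≤ ENNReal.ofReal (ε ^ (n+2) / ρ ^ (n+2)) *
        (2 ^ (n + 3) * (ENNReal.ofReal (3 * ρ / ε) ^ (n + 2) * Kf ε E (ball c ρ))) := by gcongr
    _ = 2 ^ (n + 3) * (ENNReal.ofReal (ε ^ (n+2) / ρ ^ (n+2)) * ENNReal.ofReal (3 * ρ / ε) ^ (n + 2)) * Kf ε E (ball c ρ) := by ring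
    _ = _ := by rw [hfac2]

lemma Kf_sum {ι : Type*} (s : Finset ι) (B : ι → Set (Euc N)) {E A : Set (Euc N)} (hE : MeasurableSet E)
    (hB : ∀ i ∈ s, MeasurableSet (B i)) (hd : (s : Set ι).PairwiseDisjoint B) (hBA : ∀ i ∈ s, B i ⊆ A) (ε : ℝ) :
    ∑ i ∈ s, Kf ε E (B i) ≤ Kf ε E A := by
  unfold Kf
  rw [← lintegral_finsetSum' _ fun i hi => (measurable_Sh hE (hB i hi)).aemeasurable]
  refine lintegral_mono fun h => ?_
  rw [← measure_biUnion_finset]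
  · exact measure_mono (iUnion₂_subset fun i hi => inter_subset_inter_left _ (hBA i hi))
  · exact hd.mono_on fun i _ => inter_subset_left
  · exact fun i hi => (hB i hi).inter (measurableSet_Sh hE h)

lemma ball_in {Ω : Set (Euc N)} {δ ρ : ℝ} (hδ : 0 < δ) (hρ : ρ ≤ δ) {x : Euc N} (hx : x ∉ cthickening (2 * δ) Ωᶜ) :
    ball x ρ ⊆ (cthickening δ Ωᶜ)ᶜ := by
  intro y hy hyc
  apply hx
  rw [mem_cthickening_iff] at hyc ⊢
  have h1 : edist x y ≤ ENNReal.ofReal δ := by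
    rw [edist_dist, dist_comm]
    exact ENNReal.ofReal_le_ofReal ((mem_ball.1 hy).le.trans hρ)
  calc _ ≤ infEDist y Ωᶜ + edist x y := infEDist_le_infEDist_add_edist
    _ ≤ ENNReal.ofReal δ + ENNReal.ofReal δ := add_le_add hyc h1
    _ = _ := by rw [← ENNReal.ofReal_add hδ.le hδ.le]; congr 1; ring

lemma radius {n : ℕ} {u : Euc (n+1) → ℝ} {Ω : Set (Euc (n+1))} {δ r t : ℝ} (hm : Measurable u)
    (hδ : 0 < δ) (hr : 0 < r) (hrδ : r ≤ δ) {x : Euc (n+1)} (hx : x ∉ cthickening (2 * δ) Ωᶜ)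
    (hd : HasDensity {y | y ∈ Ω ∧ u y ≤ t} x 0)
    (hE : 2 * volume {y | t < u y} < volume (ball x r)) :
    ∃ ρ, 0 < ρ ∧ ρ ≤ r ∧ volume (ball x ρ) ≤ 2 ^ (n + 2) * volume ({y | t < u y} ∩ ball x ρ) ∧
      volume (ball x ρ) ≤ 2 * volume (ball x ρ \ {y | t < u y}) := by
  classical
  set E := {y | t < u y} with hEd
  have hEm : MeasurableSet E := measurableSet_lt measurable_const hm
  let R : ℕ → ℝ := fun j => r * (1/2) ^ j
  have hR0 : ∀ j, 0 < R j := fun j => by positivity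
  have hRr : ∀ j, R j ≤ r := fun j => mul_le_of_le_one_right hr.le (pow_le_one₀ (by norm_num) (by norm_num))
  have hsplit : ∀ ρ, volume (ball x ρ) = volume (E ∩ ball x ρ) + volume (ball x ρ \ E) := fun ρ => by
    rw [inter_comm]; exact (measure_inter_add_sdiff _ hEm).symm
  have half : ∀ ρ, ¬ (volume (ball x ρ) ≤ 2 * volume (E ∩ ball x ρ)) → volume (ball x ρ) ≤ 2 * volume (ball x ρ \ E) := by
    intro ρ hlt
    by_contra h2
    push Not at hlt h2
    have h3 := ENNReal.add_lt_add hlt h2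
    rw [← mul_add, ← hsplit, two_mul] at h3
    exact lt_irrefl _ h3
  have hex : ∃ j, volume (ball x (R j)) ≤ 2 * volume (E ∩ ball x (R j)) := by
    have hT : Tendsto R atTop (𝓝[>] 0) := by
      refine tendsto_nhdsWithin_iff.2 ⟨?_, Eventually.of_forall hR0⟩
      have := (tendsto_pow_atTop_nhds_zero_of_lt_one (r := (1/2 : ℝ)) (by norm_num) (by norm_num)).const_mul r
      rw [mul_zero] at this; exact this
    have h1 := hd.comp hT
    rw [ENNReal.ofReal_zero] at h1
    obtain ⟨j, hj⟩ := (h1.eventually (gt_mem_nhds (show (0 : ℝ≥0∞) < 2⁻¹ by simp))).exists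
    refine ⟨j, ?_⟩
    by_contra h2
    have h3 := half _ h2
    simp only [Function.comp] at hj
    have hsub : ball x (R j) \ E ⊆ {y | y ∈ Ω ∧ u y ≤ t} ∩ ball x (R j) := by
      intro y hy
      refine ⟨⟨?_, not_lt.1 hy.2⟩, hy.1⟩
      by_contra hyΩ
      exact ball_in hδ ((hRr j).trans hrδ) hx hy.1 (self_subset_cthickening _ hyΩ)
    have hb0 : volume (ball x (R j)) ≠ 0 := (measure_ball_pos _ _ (hR0 j)).ne'
    have hbt : volume (ball x (R j)) ≠ ⊤ := measure_ball_lt_top.ne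
    rw [ENNReal.div_lt_iff (Or.inl hb0) (Or.inl hbt)] at hj
    have h4 : volume (ball x (R j)) < volume (ball x (R j)) := by
      calc _ ≤ 2 * volume (ball x (R j) \ E) := h3
        _ ≤ 2 * volume ({y | y ∈ Ω ∧ u y ≤ t} ∩ ball x (R j)) := by gcongr
        _ < 2 * (2⁻¹ * volume (ball x (R j))) := by
          rwa [ENNReal.mul_lt_mul_iff_right (by simp) (by simp)]
        _ = _ := by rw [← mul_assoc, ENNReal.mul_inv_cancel (by simp) (by simp), one_mul]
    exact lt_irrefl _ h4
  have hspec := Nat.find_spec hex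
  rcases hj : Nat.find hex with _ | i
  · exfalso
    rw [hj] at hspec
    have : R 0 = r := by simp [R]
    rw [this] at hspec
    refine absurd (hspec.trans ?_) (not_le.2 hE)
    gcongr
    exact inter_subset_left
  · rw [hj] at hspec
    have hni := Nat.find_min hex (m := i) (by omega)
    refine ⟨R i, hR0 i, hRr i, ?_, half _ hni⟩
    have hRi : R i = 2 * R (i + 1) := by simp only [R]; rw [pow_succ]; ring
    have hv : volume (ball x (R i)) = 2 ^ (n + 1) * volume (ball x (R (i + 1))) := by
      rw [Measure.addHaar_ball _ _ (hR0 i).le, Measure.addHaar_ball _ _ (hR0 (i+1)).le, finrank_euclideanSpace_fin, hRi,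
        mul_pow, ENNReal.ofReal_mul (by positivity), ENNReal.ofReal_pow (by norm_num)]
      norm_num
      ring
    calc _ = 2 ^ (n + 1) * volume (ball x (R (i + 1))) := hv
      _ ≤ 2 ^ (n + 1) * (2 * volume (E ∩ ball x (R (i + 1)))) := by gcongr
      _ = 2 ^ (n + 2) * volume (E ∩ ball x (R (i + 1))) := by ring
      _ ≤ _ := by
        gcongr
        rw [hRi]; linarith [hR0 (i+1)]

lemma markov_level {u : Euc N → ℝ} (hu : Integrable u) {b : ℝ≥0∞} (hb : 0 < b) (hbt : b ≠ ⊤) :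
    ∃ T : ℝ, ∀ t > T, volume {y | t < u y} < b := by
  set L := ∫⁻ x, ‖u x‖ₑ with hL
  have hLt : L ≠ ⊤ := hu.2.ne
  have hq : L / b ≠ ⊤ := ENNReal.div_ne_top hLt hb.ne'
  refine ⟨(L / b).toReal, fun t ht => ?_⟩
  by_contra hcon
  push Not at hcon
  have ht0 : 0 < t := ENNReal.toReal_nonneg.trans_lt ht
  have h1 := mul_meas_ge_le_lintegral₀ (μ := (volume : Measure (Euc N))) (f := fun x => ‖u x‖ₑ) hu.1.enorm (ENNReal.ofReal t)
  have h2 : {y | t < u y} ⊆ {x | ENNReal.ofReal t ≤ ‖u x‖ₑ} := by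
    intro y hy
    have hy' : t < u y := hy
    change ENNReal.ofReal t ≤ ‖u y‖ₑ
    rw [← ofReal_norm]
    exact ENNReal.ofReal_le_ofReal (hy'.le.trans (le_abs_self _))
  have h3 : ENNReal.ofReal t * b ≤ L :=
    (mul_le_mul_right (hcon.trans (measure_mono h2)) _).trans h1
  have h4 : L / b < ENNReal.ofReal t := (ENNReal.lt_ofReal_iff_toReal_lt hq).2 ht
  rw [ENNReal.div_lt_iff (Or.inl hb.ne') (Or.inl hbt)] at h4
  exact absurd h3 (not_le.2 h4)

lemma core_cover {n : ℕ} {u : Euc (n+1) → ℝ} (hu : Integrable u) (hm : Measurable u) {Ω : Set (Euc (n+1))}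
    (hz : ∀ x, x ∉ Ω → u x = 0) (hV : variation u Ω ≠ ⊤) {C : Set (Euc (n+1))} {δ r : ℝ} (hδ : 0 < δ)
    (hC : ∀ x ∈ C, x ∉ cthickening (2 * δ) Ωᶜ) (hd : ∀ x ∈ C, ∀ t, HasDensity {y | y ∈ Ω ∧ u y ≤ t} x 0)
    (hr : 0 < r) (hrδ : r ≤ δ) {η : ℝ≥0∞} (hη : 0 < η) :
    ∃ (v : Set (Euc (n+1))) (ρ : Euc (n+1) → ℝ), v.Countable ∧ (∀ x ∈ v, 0 < ρ x ∧ ρ x ≤ r) ∧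
      C ⊆ ⋃ x : v, closedBall x.1 (5 * ρ x.1) ∧
      ∑' x : v, ENNReal.ofReal (ρ x.1 ^ n) ≤ (2 ^ (n + 3) * 3 ^ (n + 2)) * η / volume (ball (0 : Euc (n+1)) 1) := by
  set ω := volume (ball (0 : Euc (n+1)) 1) with hω
  have hω0 : ω ≠ 0 := (measure_ball_pos _ _ one_pos).ne'
  have hωt : ω ≠ ⊤ := measure_ball_lt_top.ne
  set A := (cthickening δ Ωᶜ)ᶜ with hA
  have hbr : (0 : ℝ≥0∞) < volume (ball (0 : Euc (n+1)) r) / 2 :=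
    ENNReal.div_pos (measure_ball_pos _ _ hr).ne' (by simp)
  obtain ⟨T, hT⟩ := markov_level hu hbr (ENNReal.div_ne_top measure_ball_lt_top.ne (by simp))
  obtain ⟨t, htT, hfreq⟩ := good_level hu hm hz hV hδ T hη
  set E := {y | t < u y} with hE
  have hEm : MeasurableSet E := measurableSet_lt measurable_const hm
  have hEv : ∀ x : Euc (n+1), 2 * volume E < volume (ball x r) := by
    intro x
    have := hT t htT
    rw [ENNReal.lt_div_iff_mul_lt (Or.inl (by simp)) (Or.inl (by simp)), mul_comm] at this
    rwa [Measure.addHaar_ball_center]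
  have hrad : ∀ x, ∃ ρ, x ∈ C → (0 < ρ ∧ ρ ≤ r ∧ volume (ball x ρ) ≤ 2 ^ (n + 2) * volume (E ∩ ball x ρ) ∧
      volume (ball x ρ) ≤ 2 * volume (ball x ρ \ E)) := by
    intro x
    by_cases hx : x ∈ C
    · obtain ⟨ρ, h⟩ := radius hm hδ hr hrδ (hC x hx) (hd x hx t) (hEv x)
      exact ⟨ρ, fun _ => h⟩
    · exact ⟨0, fun h => absurd h hx⟩
  choose ρ hρ using hrad
  obtain ⟨v, hvC, hvd, hvcov⟩ := Vitali.exists_disjoint_subfamily_covering_enlargement_closedBall C (fun x => x) ρ r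
    (fun a ha => (hρ a ha).2.1) 5 (by norm_num)
  refine ⟨v, ρ, ?_, fun x hx => ⟨(hρ x (hvC hx)).1, (hρ x (hvC hx)).2.1⟩, ?_, ?_⟩
  · refine hvd.countable_of_nonempty_interior fun x hx => ?_
    exact ⟨x, ball_subset_interior_closedBall (mem_ball_self (hρ x (hvC hx)).1)⟩
  · intro x hx
    obtain ⟨b, hb, hsub⟩ := hvcov x hx
    exact mem_iUnion.2 ⟨⟨b, hb⟩, hsub (mem_closedBall_self (hρ x hx).1.le)⟩
  · rw [ENNReal.tsum_eq_iSup_sum]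
    refine iSup_le fun s => ?_
    rw [ENNReal.le_div_iff_mul_le (Or.inl hω0) (Or.inl hωt)]
    have hsmall : ∀ᶠ k : ℕ in atTop, ∀ x ∈ s, δ / ((k : ℝ) + 1) ≤ ρ x.1 := by
      rw [Filter.eventually_all_finset]
      intro x _
      have h1 : Tendsto (fun k : ℕ => δ / ((k : ℝ) + 1)) atTop (𝓝 0) := by
        have := (tendsto_one_div_add_atTop_nhds_zero_nat (𝕜 := ℝ)).const_mul δ
        simpa [div_eq_mul_inv] using this
      exact (h1.eventually (gt_mem_nhds (hρ x.1 (hvC x.2)).1)).mono fun k hk => hk.le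
    obtain ⟨k, hk, hks⟩ := (hfreq.and_eventually hsmall).exists
    set ε := δ / ((k : ℝ) + 1) with hε
    have hε0 : 0 < ε := by positivity
    set X := ENNReal.ofReal ε * volume (ball (0 : Euc (n+1)) ε) with hX
    have hX0 : X ≠ 0 := mul_ne_zero (by simpa using hε0) (measure_ball_pos _ _ hε0).ne'
    have hXt : X ≠ ⊤ := ENNReal.mul_ne_top ENNReal.ofReal_ne_top measure_ball_lt_top.ne
    have hsum : ∑ x ∈ s, Kf ε E (ball x.1 (ρ x.1)) ≤ Kf ε E A := by
      refine Kf_sum s (fun x : v => ball x.1 (ρ x.1)) hEm (fun _ _ => measurableSet_ball) ?_ ?_ ε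
      · intro x _ y _ hxy
        have := hvd x.2 y.2 (fun h => hxy (Subtype.ext h))
        exact this.mono ball_subset_closedBall ball_subset_closedBall
      · exact fun x _ => ball_in hδ ((hρ x.1 (hvC x.2)).2.1.trans hrδ) (hC x.1 (hvC x.2))
    have hfin : X * ((∑ x ∈ s, ENNReal.ofReal (ρ x.1 ^ n)) * ω) ≤ X * (2 ^ (n + 3) * 3 ^ (n + 2) * η) := by
      calc _ = ∑ x ∈ s, ENNReal.ofReal (ρ x.1 ^ n) * X * ω := by
            rw [Finset.sum_mul, Finset.mul_sum]
            exact Finset.sum_congr rfl fun x _ => by ring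
        _ ≤ ∑ x ∈ s, (2 ^ (n + 3) * 3 ^ (n + 2)) * Kf ε E (ball x.1 (ρ x.1)) :=
            Finset.sum_le_sum fun x hx => iso_final hEm x.1 hε0 (hks x hx) (hρ x.1 (hvC x.2)).2.2.1 (hρ x.1 (hvC x.2)).2.2.2
        _ = (2 ^ (n + 3) * 3 ^ (n + 2)) * ∑ x ∈ s, Kf ε E (ball x.1 (ρ x.1)) := by rw [Finset.mul_sum]
        _ ≤ (2 ^ (n + 3) * 3 ^ (n + 2)) * (η * X) := by gcongr; exact hsum.trans hk
        _ = _ := by ring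
    exact (ENNReal.mul_le_mul_iff_right hX0 hXt).1 hfin

lemma core_local {n : ℕ} {u : Euc (n+1) → ℝ} (hu : Integrable u) (hm : Measurable u) {Ω : Set (Euc (n+1))}
    (hz : ∀ x, x ∉ Ω → u x = 0) (hV : variation u Ω ≠ ⊤) {C : Set (Euc (n+1))} {δ : ℝ} (hδ : 0 < δ)
    (hC : ∀ x ∈ C, x ∉ cthickening (2 * δ) Ωᶜ) (hd : ∀ x ∈ C, ∀ t, HasDensity {y | y ∈ Ω ∧ u y ≤ t} x 0) :
    (μH[(n : ℝ)] : Measure (Euc (n+1))) C = 0 := by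
  have hr0 : ∀ k : ℕ, 0 < δ / ((k : ℝ) + 1) := fun k => by positivity
  have hrδ : ∀ k : ℕ, δ / ((k : ℝ) + 1) ≤ δ := fun k =>
    div_le_self hδ.le (by linarith [(Nat.cast_nonneg k : (0:ℝ) ≤ k)])
  have hη0 : ∀ k : ℕ, (0 : ℝ≥0∞) < ((k : ℝ≥0∞))⁻¹ := fun k => by simp
  choose v ρ hvc hρ hcov hsum using fun k : ℕ => core_cover hu hm hz hV hδ hC hd (hr0 k) (hrδ k) (hη0 k)
  have : ∀ k, Countable (v k) := fun k => (hvc k).to_subtype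
  set c : ℝ≥0∞ := (2 ^ (n + 3) * 3 ^ (n + 2)) with hc
  have hct : c ≠ ⊤ := ENNReal.mul_ne_top (by simp) (by simp)
  set ω := volume (ball (0 : Euc (n+1)) 1) with hω
  have hω0 : ω ≠ 0 := (measure_ball_pos _ _ one_pos).ne'
  have hdiam : ∀ k (x : v k), ediam (closedBall x.1 (5 * ρ k x.1)) ≤ ENNReal.ofReal (10 * ρ k x.1) := by
    intro k x
    rw [← closedEBall_ofReal (by linarith [(hρ k x.1 x.2).1])]
    refine ediam_closedEBall_le.trans (le_of_eq ?_)
    rw [show (2 : ℝ≥0∞) = ENNReal.ofReal 2 by norm_num, ← ENNReal.ofReal_mul (by norm_num)]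
    congr 1; ring
  have hlim := Measure.hausdorffMeasure_le_liminf_tsum (β := ℕ) (ι := fun k => v k) (n : ℝ) C (l := atTop)
    (fun k => ENNReal.ofReal (10 * (δ / ((k : ℝ) + 1)))) ?_ (fun k x => closedBall x.1 (5 * ρ k x.1)) ?_ ?_
  · have hb : ∀ k : ℕ, ∑' x : v k, ediam (closedBall x.1 (5 * ρ k x.1)) ^ (n : ℝ) ≤
        (ENNReal.ofReal (10 ^ n) * c / ω) * (k : ℝ≥0∞)⁻¹ := by
      intro k
      calc _ ≤ ∑' x : v k, ENNReal.ofReal (10 ^ n) * ENNReal.ofReal (ρ k x.1 ^ n) := by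
            refine ENNReal.tsum_le_tsum fun x => ?_
            rw [ENNReal.rpow_natCast]
            refine (pow_le_pow_left' (hdiam k x) n).trans (le_of_eq ?_)
            have := (hρ k x.1 x.2).1
            rw [← ENNReal.ofReal_pow (by positivity), ← ENNReal.ofReal_mul (by positivity), mul_pow]
        _ = ENNReal.ofReal (10 ^ n) * ∑' x : v k, ENNReal.ofReal (ρ k x.1 ^ n) := ENNReal.tsum_mul_left
        _ ≤ ENNReal.ofReal (10 ^ n) * (c * (k : ℝ≥0∞)⁻¹ / ω) := by gcongr; exact hsum k
        _ = _ := by simp only [div_eq_mul_inv]; ring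
    have h0 : Tendsto (fun k : ℕ => (ENNReal.ofReal (10 ^ n) * c / ω) * (k : ℝ≥0∞)⁻¹) atTop (𝓝 0) := by
      have := ENNReal.Tendsto.const_mul (a := ENNReal.ofReal (10 ^ n) * c / ω) ENNReal.tendsto_inv_nat_nhds_zero
        (Or.inr (ENNReal.div_ne_top (ENNReal.mul_ne_top ENNReal.ofReal_ne_top hct) hω0))
      simpa using this
    have h1 := hlim.trans (liminf_le_liminf (Eventually.of_forall hb))
    rw [h0.liminf_eq] at h1
    exact le_antisymm h1 zero_le
  · have h1 : Tendsto (fun k : ℕ => 10 * (δ / ((k : ℝ) + 1))) atTop (𝓝 0) := by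
      have := (tendsto_one_div_add_atTop_nhds_zero_nat (𝕜 := ℝ)).const_mul (10 * δ)
      simp only [mul_zero] at this
      refine this.congr fun k => ?_
      ring
    have := ENNReal.tendsto_ofReal h1
    simpa using this
  · refine Eventually.of_forall fun k x => (hdiam k x).trans ?_
    exact ENNReal.ofReal_le_ofReal (by linarith [(hρ k x.1 x.2).2])
  · exact Eventually.of_forall hcov

lemma core {n : ℕ} {u : Euc (n+1) → ℝ} (hu : Integrable u) (hm : Measurable u) {Ω : Set (Euc (n+1))} (hΩ : IsOpen Ω)
    (hz : ∀ x, x ∉ Ω → u x = 0) (hV : variation u Ω ≠ ⊤) {C : Set (Euc (n+1))} (hCΩ : C ⊆ Ω)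
    (hd : ∀ x ∈ C, ∀ t, HasDensity {y | y ∈ Ω ∧ u y ≤ t} x 0) :
    (μH[(n : ℝ)] : Measure (Euc (n+1))) C = 0 := by
  have hsub : C ⊆ ⋃ k : ℕ, C \ cthickening (2 * (1 / ((k : ℝ) + 1))) Ωᶜ := by
    intro x hx
    have h1 : ∃ ε > 0, ball x ε ⊆ Ω := Metric.isOpen_iff.1 hΩ x (hCΩ hx)
    obtain ⟨ε, hε, hb⟩ := h1
    obtain ⟨k, hk⟩ := exists_nat_one_div_lt (show 0 < ε / 2 by positivity)
    refine mem_iUnion.2 ⟨k, hx, fun hc => ?_⟩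
    have h2 : cthickening (2 * (1 / ((k : ℝ) + 1))) Ωᶜ ⊆ thickening ε Ωᶜ :=
      cthickening_subset_thickening' hε (by linarith) _
    obtain ⟨z, hz, hxz⟩ := mem_thickening_iff.1 (h2 hc)
    exact hz (hb (by rwa [mem_ball, dist_comm]))
  refine measure_mono_null hsub (measure_iUnion_null fun k => ?_)
  exact core_local hu hm hz hV (δ := 1 / ((k : ℝ) + 1)) (by positivity) (fun x hx => hx.2) (fun x hx => hd x hx.1)

lemma HasDensity.mono_ae {A B : Set (Euc N)} {x : Euc N} (hB : HasDensity B x 0)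
    (h : ∀ᵐ y, y ∈ A → y ∈ B) : HasDensity A x 0 := by
  unfold HasDensity at *
  rw [ENNReal.ofReal_zero] at *
  refine tendsto_of_tendsto_of_tendsto_of_le_of_le tendsto_const_nhds hB (fun _ => zero_le) fun ρ => ?_
  refine ENNReal.div_le_div_right (measure_mono_ae ?_) _
  filter_upwards [h] with y hy hyA
  exact ⟨hy hyA.1, hyA.2⟩

lemma diverg_neg (φ : Euc N → Euc N) (x : Euc N) : diverg (-φ) x = - diverg φ x := by
  unfold diverg
  rw [fderiv_neg, ← Finset.sum_neg_distrib]
  rfl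

lemma variation_neg_le (u : Euc N → ℝ) (Ω : Set (Euc N)) : variation (fun x => - u x) Ω ≤ variation u Ω := by
  refine iSup₂_le fun φ hφ => ?_
  have hφ' : -φ ∈ TestVF Ω := by
    refine ⟨hφ.1.neg, hφ.2.1.neg, ?_, fun x => ?_⟩
    · rw [tsupport_neg]; exact hφ.2.2.1
    · rw [Pi.neg_apply, norm_neg]; exact hφ.2.2.2 x
  refine le_trans (le_of_eq ?_)
    (le_iSup₂ (f := fun φ (_ : φ ∈ TestVF Ω) => ENNReal.ofReal (∫ x in Ω, u x * diverg φ x)) (-φ) hφ')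
  congr 2
  ext x
  rw [diverg_neg]; ring

lemma variation_congr {u w : Euc N → ℝ} {Ω : Set (Euc N)} (h : u =ᵐ[volume.restrict Ω] w) :
    variation u Ω = variation w Ω := by
  unfold variation
  refine iSup_congr fun φ => iSup_congr fun _ => ?_
  congr 1
  refine integral_congr_ae ?_
  filter_upwards [h] with x hx
  rw [hx]

lemma lower_top {u : Euc N → ℝ} {Ω : Set (Euc N)} {x : Euc N} (h : approxLower u Ω x = ⊤) (t : ℝ) :
    ∃ s > t, HasDensity {y | y ∈ Ω ∧ u y < s} x 0 := by
  have h1 : ((t : ℝ) : EReal) < approxLower u Ω x := by rw [h]; exact EReal.coe_lt_top t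
  obtain ⟨_, ⟨s, rfl, hs⟩, hts⟩ := lt_sSup_iff.1 h1
  exact ⟨s, EReal.coe_lt_coe_iff.1 hts, hs⟩

lemma upper_bot {u : Euc N → ℝ} {Ω : Set (Euc N)} {x : Euc N} (h : approxUpper u Ω x = ⊥) (t : ℝ) :
    ∃ s < t, HasDensity {y | y ∈ Ω ∧ s < u y} x 0 := by
  have h1 : approxUpper u Ω x < ((t : ℝ) : EReal) := by rw [h]; exact EReal.bot_lt_coe t
  obtain ⟨_, ⟨s, rfl, hs⟩, hts⟩ := sInf_lt_iff.1 h1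
  exact ⟨s, EReal.coe_lt_coe_iff.1 hts, hs⟩

lemma a_to_b {n : ℕ} (Ω : Set (Euc (n+1))) (hΩ : IsOpen Ω) {C : Set (Euc (n+1))} (h : BVPolar C Ω) :
    (μH[(n : ℝ)] : Measure (Euc (n+1))) C = 0 := by
  obtain ⟨u, ⟨hinteg, hvar⟩, hC⟩ := h
  set g := hinteg.1.mk u with hg
  have hgm : Measurable g := hinteg.1.stronglyMeasurable_mk.measurable
  have hug : u =ᵐ[volume.restrict Ω] g := hinteg.1.ae_eq_mk
  set w := Ω.indicator g with hw
  have hwm : Measurable w := hgm.indicator hΩ.measurableSet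
  have hwi : Integrable w := (integrable_indicator_iff hΩ.measurableSet).2 (hinteg.congr_fun_ae hug)
  have hz : ∀ x, x ∉ Ω → w x = 0 := fun x hx => indicator_of_notMem hx _
  have huw' : ∀ᵐ x, x ∈ Ω → u x = w x := by
    have := (ae_restrict_iff' hΩ.measurableSet).1 hug
    filter_upwards [this] with x hx hxΩ
    rw [hw, indicator_of_mem hxΩ]; exact hx hxΩ
  have huw : u =ᵐ[volume.restrict Ω] w := (ae_restrict_iff' hΩ.measurableSet).2 huw'
  have hVw : variation w Ω ≠ ⊤ := by rw [← variation_congr huw]; exact hvar.ne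
  have hVn : variation (fun x => - w x) Ω ≠ ⊤ := ((variation_neg_le w Ω).trans_lt hVw.lt_top).ne
  have hsub : C ⊆ {x | x ∈ Ω ∧ approxLower u Ω x = ⊤} ∪ {x | x ∈ Ω ∧ approxUpper u Ω x = ⊥} := by
    intro x hx
    obtain ⟨h1, h2 | h2⟩ := hC hx
    · exact Or.inl ⟨h1, h2.2⟩
    · exact Or.inr ⟨h1, h2.1⟩
  refine measure_mono_null hsub (measure_union_null ?_ ?_)
  · refine core hwi hwm hΩ hz hVw (fun x hx => hx.1) fun x hx t => ?_
    obtain ⟨s, hs, hd⟩ := lower_top hx.2 t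
    refine hd.mono_ae ?_
    filter_upwards [huw'] with y hy hyA
    exact ⟨hyA.1, by rw [hy hyA.1]; exact hyA.2.trans_lt hs⟩
  · refine core (u := fun x => - w x) hwi.neg hwm.neg hΩ (fun x hx => by rw [hz x hx, neg_zero]) hVn (fun x hx => hx.1)
      fun x hx t => ?_
    obtain ⟨s, hs, hd⟩ := upper_bot hx.2 (-t)
    refine hd.mono_ae ?_
    filter_upwards [huw'] with y hy hyA
    refine ⟨hyA.1, ?_⟩
    have h2 : - w y ≤ t := hyA.2
    rw [hy hyA.1]; linarith

lemma not_density_univ (x : Euc N) : ¬ HasDensity univ x 0 := by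
  intro h
  unfold HasDensity at h
  rw [ENNReal.ofReal_zero] at h
  have h1 : Tendsto (fun ρ : ℝ => volume (univ ∩ ball x ρ) / volume (ball x ρ)) (𝓝[>] 0) (𝓝 1) := by
    refine tendsto_const_nhds.congr' ?_
    filter_upwards [self_mem_nhdsWithin] with ρ hρ
    rw [univ_inter, ENNReal.div_self (measure_ball_pos _ _ hρ).ne' measure_ball_lt_top.ne]
  exact zero_ne_one (tendsto_nhds_unique h h1)

lemma a_zero (Ω : Set (Euc 0)) {C : Set (Euc 0)} (h : BVPolar C Ω) : C = ∅ := by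
  obtain ⟨u, -, hC⟩ := h
  rw [eq_empty_iff_forall_notMem]
  intro x hx
  obtain ⟨hxΩ, h2 | h2⟩ := hC hx
  · obtain ⟨s, hs, hd⟩ := lower_top h2.2 (u x)
    have : {y | y ∈ Ω ∧ u y < s} = univ := by
      refine eq_univ_of_forall fun y => ?_
      rw [Subsingleton.elim y x]; exact ⟨hxΩ, hs⟩
    rw [this] at hd
    exact not_density_univ x hd
  · obtain ⟨s, hs, hd⟩ := upper_bot h2.1 (u x)
    have : {y | y ∈ Ω ∧ s < u y} = univ := by
      refine eq_univ_of_forall fun y => ?_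
      rw [Subsingleton.elim y x]; exact ⟨hxΩ, hs⟩
    rw [this] at hd
    exact not_density_univ x hd

lemma c_of_empty (Ω : Set (Euc N)) {C : Set (Euc N)} (hC : C = ∅) :
    ∃ U : ℕ → Set (Euc N), (∀ k, IsOpen (U k) ∧ U k ⊆ Ω ∧ C ⊆ U k) ∧
        Tendsto (fun k => volume (U k)) atTop (𝓝 0) ∧
        Tendsto (fun k => perimeter (U k) Ω) atTop (𝓝 0) := by
  refine ⟨fun _ => ∅, fun k => ⟨isOpen_empty, empty_subset _, hC.le⟩, ?_, ?_⟩
  · simp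
  · simp [perimeter_empty]

lemma b_to_c_all (Ω : Set (Euc N)) (hΩ : IsOpen Ω) {C : Set (Euc N)} (hCΩ : C ⊆ Ω)
    (h : (μH[(N : ℝ) - 1] : Measure (Euc N)) C = 0) :
    ∃ U : ℕ → Set (Euc N), (∀ k, IsOpen (U k) ∧ U k ⊆ Ω ∧ C ⊆ U k) ∧
        Tendsto (fun k => volume (U k)) atTop (𝓝 0) ∧
        Tendsto (fun k => perimeter (U k) Ω) atTop (𝓝 0) := by
  rcases N with _ | n
  · exact c_of_empty Ω (hausdorff_empty (by simp) h)
  · rcases Nat.eq_zero_or_pos n with rfl | hn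
    · exact c_of_empty Ω (hausdorff_empty (by simp) h)
    · rw [show ((n + 1 : ℕ) : ℝ) - 1 = n by push_cast; ring] at h
      exact b_to_c hn Ω hΩ hCΩ h

lemma a_to_b_all (Ω : Set (Euc N)) (hΩ : IsOpen Ω) {C : Set (Euc N)} (h : BVPolar C Ω) :
    (μH[(N : ℝ) - 1] : Measure (Euc N)) C = 0 := by
  rcases N with _ | n
  · rw [a_zero Ω h, measure_empty]
  · rw [show ((n + 1 : ℕ) : ℝ) - 1 = n by push_cast; ring]
    exact a_to_b Ω hΩ h

/-- For `C ⊆ Ω ⊆ ℝ^N` (`Ω` open), the following are equivalent: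
(a) `C` is `BV`-polar in `Ω`; (b) `H^{N-1}(C) = 0`;
(c) there is a sequence of open sets `U_k ⊆ Ω` containing `C` with `λ^N(U_k) → 0`
and `P(U_k, Ω) → 0`. -/
theorem statement1 {N : ℕ} (Ω : Set (Euc N)) (hΩ : IsOpen Ω)
    (C : Set (Euc N)) (hC : C ⊆ Ω) :
    (BVPolar C Ω ↔ (μH[(N : ℝ) - 1] : Measure (Euc N)) C = 0) ∧
    ((μH[(N : ℝ) - 1] : Measure (Euc N)) C = 0 ↔
      ∃ U : ℕ → Set (Euc N), (∀ k, IsOpen (U k) ∧ U k ⊆ Ω ∧ C ⊆ U k) ∧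
        Tendsto (fun k => volume (U k)) atTop (𝓝 0) ∧
        Tendsto (fun k => perimeter (U k) Ω) atTop (𝓝 0)) := by
  have hab : BVPolar C Ω → (μH[(N : ℝ) - 1] : Measure (Euc N)) C = 0 := a_to_b_all Ω hΩ
  have hbc := b_to_c_all (C := C) Ω hΩ hC
  have hca := c_to_a Ω hΩ hC
  exact ⟨⟨hab, fun h => hca (hbc h)⟩, ⟨hbc, fun h => hab (hca h)⟩⟩
end
end

section
/- Let Ω ⊆ ℝ be open and C ⊆ Ω. Then C is GBV-polar in Ω if and only if λ^1(cl(C) ∩ Ω) = 0, where cl(C) is the closure of C in ℝ. -/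
open MeasureTheory Metric Filter Set
open scoped ENNReal Topology

noncomputable section

/-- The total variation `V(u, Ω)` for `u : ℝ → ℝ` on `Ω ⊆ ℝ`. -/
def variation1 (u : ℝ → ℝ) (Ω : Set ℝ) : ℝ≥0∞ :=
  ⨆ φ ∈ {φ : ℝ → ℝ | ContDiff ℝ 1 φ ∧ HasCompactSupport φ ∧ tsupport φ ⊆ Ω ∧ ∀ x, |φ x| ≤ 1},
    ENNReal.ofReal (∫ x in Ω, u x * deriv φ x)

/-- `u ∈ BV(Ω)` for `Ω ⊆ ℝ`. -/
def MemBV1 (u : ℝ → ℝ) (Ω : Set ℝ) : Prop :=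
  IntegrableOn u Ω volume ∧ variation1 u Ω < ⊤

/-- `u ∈ BV_loc(Ω)` for `Ω ⊆ ℝ`. -/
def MemBVloc1 (u : ℝ → ℝ) (Ω : Set ℝ) : Prop :=
  ∀ Ω' : Set ℝ, IsOpen Ω' → IsCompact (closure Ω') → closure Ω' ⊆ Ω → MemBV1 u Ω'

/-- `u ∈ GBV(Ω)` for `Ω ⊆ ℝ`. -/
def MemGBV1 (u : ℝ → ℝ) (Ω : Set ℝ) : Prop :=
  AEMeasurable u (volume.restrict Ω) ∧
    ∀ m : ℝ, 0 < m → MemBVloc1 (fun x => max (-m) (min (u x) m)) Ω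

/-- `A ⊆ ℝ` has density `t` at `x`. -/
def HasDensity1 (A : Set ℝ) (x : ℝ) (t : ℝ) : Prop :=
  Tendsto (fun ρ : ℝ => volume (A ∩ ball x ρ) / volume (ball x ρ)) (𝓝[>] 0)
    (𝓝 (ENNReal.ofReal t))

/-- Approximate upper limit `u⁺(x)` with `inf ∅ = ⊤`. -/
def approxUpper1 (u : ℝ → ℝ) (Ω : Set ℝ) (x : ℝ) : EReal :=
  sInf {t : EReal | ∃ s : ℝ, t = (s : EReal) ∧ HasDensity1 {y | y ∈ Ω ∧ s < u y} x 0}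

/-- Approximate lower limit `u⁻(x)` with `sup ∅ = ⊥`. -/
def approxLower1 (u : ℝ → ℝ) (Ω : Set ℝ) (x : ℝ) : EReal :=
  sSup {t : EReal | ∃ s : ℝ, t = (s : EReal) ∧ HasDensity1 {y | y ∈ Ω ∧ u y < s} x 0}

/-- The approximate limit `ũ(x)` exists and `|ũ(x)| = +∞`. -/
def HasInfApproxLimit1 (u : ℝ → ℝ) (Ω : Set ℝ) (x : ℝ) : Prop :=
  (approxUpper1 u Ω x = ⊤ ∧ approxLower1 u Ω x = ⊤) ∨
    (approxUpper1 u Ω x = ⊥ ∧ approxLower1 u Ω x = ⊥)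

/-- `C` is `GBV`-polar in `Ω ⊆ ℝ`. -/
def GBVPolar1 (C Ω : Set ℝ) : Prop :=
  ∃ u : ℝ → ℝ, MemGBV1 u Ω ∧ C ⊆ {x | x ∈ Ω ∧ HasInfApproxLimit1 u Ω x}

lemma aux_testfun (φ : ContDiffBump (0:ℝ)) (t : ℕ → ℝ) (ht : Monotone t) (n : ℕ) (s : ℕ → ℝ)
    (hs : ∀ i, |s i| ≤ 1) :
    ∃ ψ : ℝ → ℝ, ContDiff ℝ 1 ψ ∧
      (∀ x, deriv ψ x = ∑ i ∈ Finset.range n,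
        s i * (φ.normed volume (x - t i) - φ.normed volume (x - t (i+1)))) ∧
      Function.support ψ ⊆ Icc (t 0 - φ.rOut) (t n + φ.rOut) ∧ ∀ x, |ψ x| ≤ 1 := by
  set k := φ.normed (volume : Measure ℝ) with hk
  have kc : Continuous k := φ.continuous_normed
  have kint : ∀ a b, IntervalIntegrable k volume a b := fun a b => kc.intervalIntegrable a b
  have k0 : ∀ x, 0 ≤ k x := fun x => φ.nonneg_normed x
  set H : ℝ → ℝ := fun x => ∫ y in (0:ℝ)..x, k y with hH
  have Hd : ∀ x, HasDerivAt H (k x) x := fun x =>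
    intervalIntegral.integral_hasDerivAt_right (kint _ _)
      (kc.stronglyMeasurableAtFilter _ _) kc.continuousAt
  have Hsub : ∀ a b, H b - H a = ∫ y in a..b, k y := fun a b =>
    intervalIntegral.integral_interval_sub_left (kint _ _) (kint _ _)
  have Hmono : Monotone H := by
    intro a b hab
    have := Hsub a b
    have h2 : 0 ≤ ∫ y in a..b, k y := intervalIntegral.integral_nonneg hab (fun x _ => k0 x)
    linarith
  have Hone : ∀ a b, a ≤ b → H b - H a ≤ 1 := by
    intro a b hab
    rw [Hsub, intervalIntegral.integral_of_le hab, ← φ.integral_normed (μ := volume)]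
    exact setIntegral_le_integral φ.integrable_normed (Eventually.of_forall k0)
  have kz : ∀ y, φ.rOut ≤ |y| → k y = 0 := by
    intro y hy
    have : y ∉ Function.support k := by
      rw [hk, φ.support_normed_eq]; simpa using hy
    simpa using this
  have Hz : ∀ a b, a ≤ b → (φ.rOut ≤ a ∨ b ≤ - φ.rOut) → H b - H a = 0 := by
    intro a b hab h
    rw [Hsub, intervalIntegral.integral_zero_ae]
    refine Eventually.of_forall fun y hy => kz y ?_
    rw [uIoc_of_le hab] at hy
    rcases h with h | h
    · exact le_trans (by linarith [hy.1]) (le_abs_self y)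
    · exact le_trans (by linarith [hy.2]) (neg_le_abs y)
  have Hpd : ∀ x, HasDerivAt (fun x => ∑ i ∈ Finset.range n, s i * (H (x - t i) - H (x - t (i+1))))
      (∑ i ∈ Finset.range n, s i * (k (x - t i) - k (x - t (i+1)))) x := by
    intro x
    refine HasDerivAt.fun_sum fun i _ => ?_
    exact (((Hd _).comp_sub_const x (t i)).sub ((Hd _).comp_sub_const x (t (i+1)))).const_mul (s i)
  refine ⟨_, ?_, fun x => (Hpd x).deriv, ?_, ?_⟩
  · rw [contDiff_one_iff_deriv]
    refine ⟨fun x => (Hpd x).differentiableAt, ?_⟩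
    rw [funext fun x => (Hpd x).deriv]
    fun_prop
  · intro x hx
    by_contra hx'
    apply hx
    refine Finset.sum_eq_zero fun i hi => ?_
    have h1 : t i ≤ t (i+1) := ht (Nat.le_succ i)
    have h2 : t 0 ≤ t i := ht (Nat.zero_le i)
    have h3 : t (i+1) ≤ t n := ht (Finset.mem_range.1 hi)
    rw [Hz _ _ (by linarith), mul_zero]
    by_contra hcon
    push Not at hcon
    exact hx' ⟨by linarith [hcon.2], by linarith [hcon.1]⟩
  · intro x
    have hm : ∀ i, 0 ≤ H (x - t i) - H (x - t (i+1)) := fun i =>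
      sub_nonneg.2 (Hmono (by linarith [ht (Nat.le_succ i)]))
    calc |∑ i ∈ Finset.range n, s i * (H (x - t i) - H (x - t (i+1)))|
        ≤ ∑ i ∈ Finset.range n, |s i * (H (x - t i) - H (x - t (i+1)))| :=
          Finset.abs_sum_le_sum_abs _ _
      _ ≤ ∑ i ∈ Finset.range n, (H (x - t i) - H (x - t (i+1))) := by
          refine Finset.sum_le_sum fun i _ => ?_
          rw [abs_mul, abs_of_nonneg (hm i)]
          exact mul_le_of_le_one_left (hm i) (hs i)
      _ = H (x - t 0) - H (x - t n) := Finset.sum_range_sub' (fun i => H (x - t i)) n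
      _ ≤ 1 := Hone _ _ (by linarith [ht (Nat.zero_le n)])

lemma aux_bv (v : ℝ → ℝ) (p q : ℝ) (hv : MemBV1 v (Ioo p q)) :
    ∃ G : Set ℝ, G ⊆ Ioo p q ∧ volume (Ioo p q \ G) = 0 ∧ BoundedVariationOn v G := by
  obtain ⟨hint, hvar⟩ := hv
  set g : ℝ → ℝ := (Ioo p q).indicator v with hg
  have gint : Integrable g := hint.integrable_indicator measurableSet_Ioo
  let b : ℕ → ContDiffBump (0:ℝ) := fun j =>
    ⟨1/((j:ℝ)+1), 2/((j:ℝ)+1), by positivity, by gcongr; norm_num⟩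
  have hb : Tendsto (fun j => (b j).rOut) atTop (𝓝 0) := by
    have := (tendsto_one_div_add_atTop_nhds_zero_nat (𝕜 := ℝ)).const_mul 2
    simpa [b, div_eq_mul_inv] using this
  have hae := ContDiffBump.ae_convolution_tendsto_right_of_locallyIntegrable (μ := volume) (K := 2)
    hb (Eventually.of_forall fun j => by simp [b]; ring_nf; rfl) gint.locallyIntegrable
  set L : Set ℝ := {x | Tendsto (fun j => ∫ y, (b j).normed volume (y - x) * g y) atTop (𝓝 (g x))}
    with hL
  have hLae : volume Lᶜ = 0 := by
    refine measure_mono_null ?_ hae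
    intro x hx hx'
    apply hx
    refine Tendsto.congr (fun j => ?_) hx'
    rw [convolution_eq_swap]
    refine integral_congr_ae (Eventually.of_forall fun y => ?_)
    simp only [ContinuousLinearMap.lsmul_apply, smul_eq_mul]
    rw [← (b j).normed_neg, neg_sub]
  refine ⟨Ioo p q ∩ L, inter_subset_left, measure_mono_null (fun x hx hxL => hx.2 ⟨hx.1, hxL⟩) hLae, ?_⟩
  refine ne_top_of_le_ne_top hvar.ne ?_
  refine iSup_le ?_
  rintro ⟨n, t, ht, htG⟩
  simp only
  -- signs
  set s : ℕ → ℝ := fun i => if 0 ≤ v (t i) - v (t (i+1)) then 1 else -1 with hs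
  have hs1 : ∀ i, |s i| ≤ 1 := fun i => by simp only [hs]; split_ifs <;> simp
  have hsabs : ∀ i, s i * (v (t i) - v (t (i+1))) = |v (t i) - v (t (i+1))| := fun i => by
    simp only [hs]; split_ifs with h
    · rw [abs_of_nonneg h, one_mul]
    · rw [abs_of_neg (not_le.1 h)]; ring
  have hgv : ∀ i, g (t i) = v (t i) := fun i => indicator_of_mem (htG i).1 _
  have hsum : ∑ i ∈ Finset.range n, edist (v (t (i+1))) (v (t i))
      = ENNReal.ofReal (∑ i ∈ Finset.range n, s i * (v (t i) - v (t (i+1)))) := by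
    rw [ENNReal.ofReal_sum_of_nonneg]
    · refine Finset.sum_congr rfl fun i _ => ?_
      rw [hsabs, edist_comm, edist_dist, Real.dist_eq]
    · intro i _; rw [hsabs]; exact abs_nonneg _
  rw [hsum]
  have hlim : Tendsto (fun j => ∑ i ∈ Finset.range n, s i *
      ((∫ y, (b j).normed volume (y - t i) * g y) - ∫ y, (b j).normed volume (y - t (i+1)) * g y))
      atTop (𝓝 (∑ i ∈ Finset.range n, s i * (v (t i) - v (t (i+1))))) := by
    refine tendsto_finsetSum _ fun i _ => ?_
    rw [← hgv, ← hgv]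
    exact ((htG i).2.sub (htG (i+1)).2).const_mul _
  refine le_of_tendsto (ENNReal.tendsto_ofReal hlim) ?_
  have hδ : 0 < min (t 0 - p) (q - t n) := lt_min (by linarith [(htG 0).1.1]) (by linarith [(htG n).1.2])
  filter_upwards [hb.eventually (gt_mem_nhds hδ)] with j hj
  obtain ⟨ψ, hψ1, hψd, hψs, hψb⟩ := aux_testfun (b j) t ht n s hs1
  have hts : tsupport ψ ⊆ Icc (t 0 - (b j).rOut) (t n + (b j).rOut) :=
    closure_minimal hψs isClosed_Icc
  have hcs : HasCompactSupport ψ := isCompact_Icc.of_isClosed_subset (isClosed_tsupport ψ) hts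
  have htsΩ : tsupport ψ ⊆ Ioo p q := by
    refine hts.trans fun x hx => ⟨?_, ?_⟩
    · linarith [hx.1, lt_of_lt_of_le hj (min_le_left _ _)]
    · linarith [hx.2, lt_of_lt_of_le hj (min_le_right _ _)]
  have kint : ∀ c, Integrable (fun y => (b j).normed volume (y - c) * g y) := by
    intro c
    have kc : Continuous (fun y => (b j).normed volume (y - c)) :=
      (b j).continuous_normed.comp (continuous_id.sub continuous_const)
    obtain ⟨B, hB⟩ := (b j).hasCompactSupport_normed.exists_bound_of_continuous
      ((b j).continuous_normed (μ := volume))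
    exact gint.bdd_mul kc.aestronglyMeasurable (Eventually.of_forall fun y => hB (y - c))
  have key : (∫ x in Ioo p q, v x * deriv ψ x) = ∑ i ∈ Finset.range n, s i *
      ((∫ y, (b j).normed volume (y - t i) * g y) - ∫ y, (b j).normed volume (y - t (i+1)) * g y) := by
    rw [← integral_indicator measurableSet_Ioo]
    calc _ = ∫ x, ∑ i ∈ Finset.range n, s i * ((b j).normed volume (x - t i) * g x
              - (b j).normed volume (x - t (i+1)) * g x) := by
            refine integral_congr_ae (Eventually.of_forall fun x => ?_)
            simp only [hg]
            by_cases hx : x ∈ Ioo p q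
            · simp only [indicator_of_mem hx, hψd, Finset.mul_sum]
              refine Finset.sum_congr rfl fun i _ => ?_
              ring
            · simp [indicator_of_notMem hx]
      _ = _ := by
            rw [integral_finsetSum _ fun i _ => show Integrable (fun x => s i * ((b j).normed volume (x - t i) * g x
              - (b j).normed volume (x - t (i+1)) * g x)) volume from
                ((kint (t i)).sub (kint (t (i+1)))).const_mul (s i)]
            refine Finset.sum_congr rfl fun i _ => ?_
            rw [integral_const_mul, integral_sub (kint _) (kint _)]
  rw [← key]
  exact le_iSup₂ (f := fun φ (_ : φ ∈ {φ : ℝ → ℝ | ContDiff ℝ 1 φ ∧ HasCompactSupport φ ∧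
    tsupport φ ⊆ Ioo p q ∧ ∀ x, |φ x| ≤ 1}) => ENNReal.ofReal (∫ x in Ioo p q, v x * deriv φ x))
    ψ ⟨hψ1, hcs, htsΩ, hψb⟩

/-- Near a point of infinite approximate limit the function is large somewhere on any a.e. set. -/
lemma aux_big (u : ℝ → ℝ) (Ω : Set ℝ) (c p q M : ℝ) (G : Set ℝ)
    (hsub : Ioo p q ⊆ Ω) (hc : c ∈ Ioo p q) (hG : volume (Ioo p q \ G) = 0)
    (h : HasInfApproxLimit1 u Ω c) (W : Set ℝ) (hW : W ∈ 𝓝 c) :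
    ∃ y ∈ G ∩ W, M < |u y| := by
  have main : ∀ D : Set ℝ, HasDensity1 D c 0 → ∃ y ∈ G ∩ W, y ∈ Ioo p q ∧ y ∉ D := by
    intro D hD
    unfold HasDensity1 at hD
    rw [ENNReal.ofReal_zero] at hD
    have h1 := hD.eventually (gt_mem_nhds (zero_lt_one))
    obtain ⟨r, hr, hrs⟩ := Metric.mem_nhds_iff.1 (inter_mem hW (Ioo_mem_nhds hc.1 hc.2))
    have h2 : ∀ᶠ ρ : ℝ in 𝓝[>] 0, ρ < r := mem_nhdsWithin_of_mem_nhds (gt_mem_nhds hr)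
    obtain ⟨ρ, hρ1, hρ2, hρ0⟩ := (h1.and (h2.and self_mem_nhdsWithin)).exists
    have hρ0 : 0 < ρ := hρ0
    by_contra hcon
    push Not at hcon
    have hball : ball c ρ ⊆ W ∩ Ioo p q := (ball_subset_ball hρ2.le).trans hrs
    have hle : volume (ball c ρ) ≤ volume (D ∩ ball c ρ) := by
      calc volume (ball c ρ) ≤ volume ((D ∩ ball c ρ) ∪ (Ioo p q \ G)) := by
            refine measure_mono fun y hy => ?_
            by_cases hyG : y ∈ G
            · exact Or.inl ⟨hcon y ⟨hyG, (hball hy).1⟩ (hball hy).2, hy⟩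
            · exact Or.inr ⟨(hball hy).2, hyG⟩
        _ ≤ volume (D ∩ ball c ρ) + volume (Ioo p q \ G) := measure_union_le _ _
        _ = _ := by rw [hG, add_zero]
    have hpos : volume (ball c ρ) ≠ 0 := (measure_ball_pos volume c hρ0).ne'
    have hfin : volume (ball c ρ) ≠ ⊤ := measure_ball_lt_top.ne
    have : 1 ≤ volume (D ∩ ball c ρ) / volume (ball c ρ) := by
      rw [← ENNReal.div_self hpos hfin]
      gcongr
    exact absurd hρ1 (not_lt.2 this)
  rcases h with ⟨-, h⟩ | ⟨h, -⟩
  · have : ((M:ℝ):EReal) < approxLower1 u Ω c := by rw [h]; exact EReal.coe_lt_top M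
    obtain ⟨_, ⟨s, rfl, hs⟩, hMs⟩ := lt_sSup_iff.1 this
    obtain ⟨y, hy, hyI, hyD⟩ := main _ hs
    have hMs : M < s := EReal.coe_lt_coe_iff.1 hMs
    refine ⟨y, hy, ?_⟩
    have : s ≤ u y := not_lt.1 fun h => hyD ⟨hsub hyI, h⟩
    exact lt_of_lt_of_le (by linarith) (le_abs_self _)
  · have : approxUpper1 u Ω c < (((-M:ℝ)):EReal) := by rw [h]; exact EReal.bot_lt_coe _
    obtain ⟨_, ⟨s, rfl, hs⟩, hMs⟩ := sInf_lt_iff.1 this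
    obtain ⟨y, hy, hyI, hyD⟩ := main _ hs
    have hMs : s < -M := EReal.coe_lt_coe_iff.1 hMs
    refine ⟨y, hy, ?_⟩
    have : u y ≤ s := not_lt.1 fun h => hyD ⟨hsub hyI, h⟩
    exact lt_of_lt_of_le (by linarith) (neg_le_abs _)

lemma aux_forward (Ω : Set ℝ) (hΩ : IsOpen Ω) (C : Set ℝ) (h : GBVPolar1 C Ω) :
    volume (closure C ∩ Ω) = 0 := by
  obtain ⟨u, ⟨-, hu⟩, hCu⟩ := h
  refine measure_null_of_locally_null _ fun x hx => ?_
  obtain ⟨r, hr, hrs⟩ := Metric.mem_nhds_iff.1 (hΩ.mem_nhds hx.2)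
  set p := x - r/2 with hp
  set q := x + r/2 with hq
  have hcl : closure (Ioo p q) ⊆ Ω := by
    rw [closure_Ioo (by simp only [hp, hq]; intro h; linarith)]
    refine fun y hy => hrs ?_
    rw [mem_ball, Real.dist_eq, abs_lt]
    constructor <;> linarith [hy.1, hy.2]
  have hsub : Ioo p q ⊆ Ω := subset_closure.trans hcl
  have hcpt : IsCompact (closure (Ioo p q)) := by
    rw [closure_Ioo (by simp only [hp, hq]; intro h; linarith)]; exact isCompact_Icc
  refine ⟨(closure C ∩ Ω) ∩ Ioo p q, inter_mem_nhdsWithin _ (Ioo_mem_nhds (by linarith) (by linarith)), ?_⟩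
  have hcov : (closure C ∩ Ω) ∩ Ioo p q ⊆ ⋃ m : ℕ, {y | y ∈ closure C ∧ y ∈ Ioo p q ∧ |u y| < m} := by
    intro y hy
    obtain ⟨m, hm⟩ := exists_nat_gt |u y|
    exact mem_iUnion.2 ⟨m, hy.1.1, hy.2, hm⟩
  refine measure_mono_null hcov (measure_iUnion_null fun m => ?_)
  have hmem := hu ((m:ℝ)+1) (by positivity) (Ioo p q) isOpen_Ioo hcpt hcl
  set v : ℝ → ℝ := fun x => max (-((m:ℝ)+1)) (min (u x) ((m:ℝ)+1)) with hv
  obtain ⟨G, hGI, hG0, hGv⟩ := aux_bv v p q hmem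
  obtain ⟨f1, f2, hf1, hf2, hf⟩ := hGv.locallyBoundedVariationOn.exists_monotoneOn_sub_monotoneOn
  refine measure_mono_null (t := (Ioo p q \ G) ∪ ({y ∈ G | ¬ ContinuousWithinAt f1 G y} ∪
    {y ∈ G | ¬ ContinuousWithinAt f2 G y})) ?_ ?_
  · rintro y ⟨hyC, hyI, hym⟩
    by_contra hcon
    simp only [mem_union, not_or] at hcon
    obtain ⟨h1, h2, h3⟩ := hcon
    have hyG : y ∈ G := by by_contra h; exact h1 ⟨hyI, h⟩
    have c1 : ContinuousWithinAt f1 G y := by by_contra h; exact h2 ⟨hyG, h⟩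
    have c2 : ContinuousWithinAt f2 G y := by by_contra h; exact h3 ⟨hyG, h⟩
    have cv : ContinuousWithinAt v G y := by rw [hf]; exact c1.sub c2
    have hvy : |v y| < m + 1 := by
      rw [abs_lt] at hym ⊢
      simp only [hv]
      constructor
      · refine lt_max_of_lt_right (lt_min ?_ ?_) <;> linarith
      · refine max_lt ?_ (min_lt_of_left_lt ?_) <;> linarith
    have hev : ∀ᶠ z in 𝓝[G] y, |v z| < m + 1 := cv.abs.eventually (gt_mem_nhds hvy)
    obtain ⟨W, hWo, hyW, hWs⟩ := mem_nhdsWithin.1 hev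
    obtain ⟨c, hcW, hcC⟩ := mem_closure_iff.1 hyC (W ∩ Ioo p q) (hWo.inter isOpen_Ioo) ⟨hyW, hyI⟩
    obtain ⟨z, ⟨hzG, hzW⟩, hz⟩ := aux_big u Ω c p q (m+1) G hsub hcW.2 hG0 (hCu hcC).2 W
      (hWo.mem_nhds hcW.1)
    have hvz : |v z| < m + 1 := hWs ⟨hzW, hzG⟩
    rw [abs_lt] at hvz
    simp only [hv] at hvz
    have hm0 : (0:ℝ) ≤ m := by positivity
    rcases lt_abs.1 hz with h | h
    · rw [min_eq_right h.le, max_eq_right (by linarith)] at hvz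
      linarith [hvz.2]
    · rw [min_eq_left (by linarith), max_eq_left (by linarith)] at hvz
      linarith [hvz.1]
  · refine measure_union_null hG0 (measure_union_null ?_ ?_)
    · exact hf1.countable_not_continuousWithinAt.measure_zero _
    · exact hf2.countable_not_continuousWithinAt.measure_zero _

lemma aux_lip_bv (w : ℝ → ℝ) (K : NNReal) (hw : LipschitzWith K w) (U : Set ℝ) (hU : IsOpen U)
    (hUc : IsCompact (closure U)) : MemBV1 w U := by
  have hfin : volume U ≠ ⊤ := ((measure_mono subset_closure).trans_lt hUc.measure_lt_top).ne
  refine ⟨(hw.continuous.continuousOn.integrableOn_compact hUc).mono_set subset_closure, ?_⟩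
  refine lt_of_le_of_lt (b := ENNReal.ofReal (K * volume.real U)) (iSup₂_le ?_) ENNReal.ofReal_lt_top
  rintro φ ⟨hφ, hφc, hφs, hφb⟩
  refine ENNReal.ofReal_le_ofReal ?_
  obtain ⟨D, hD⟩ := hφ.lipschitzWith_of_hasCompactSupport hφc one_ne_zero
  have h := hw.integral_lineDeriv_mul_eq (μ := volume) hD hφc (-1 : ℝ)
  have hz : ∀ x, x ∉ U → deriv φ x = 0 := fun x hx => by
    by_contra h
    exact hx (hφs (support_deriv_subset h))
  have hz' : ∀ x, x ∉ U → φ x = 0 := fun x hx => by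
    by_contra h
    exact hx (hφs (subset_tsupport _ h))
  have e1 : ∫ x in U, w x * deriv φ x = ∫ x, lineDeriv ℝ φ x (-(-1)) * w x := by
    rw [setIntegral_eq_integral_of_forall_compl_eq_zero]
    · refine integral_congr_ae (Eventually.of_forall fun x => ?_)
      simp only [neg_neg]
      rw [((hφ.differentiable one_ne_zero) x).lineDeriv_eq_fderiv, fderiv_apply_one_eq_deriv, mul_comm]
    · intro x hx; rw [hz x hx, mul_zero]
  rw [e1, ← h, ← setIntegral_eq_integral_of_forall_compl_eq_zero (s := U)]
  · refine (le_abs_self _).trans ?_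
    rw [← Real.norm_eq_abs]
    refine norm_setIntegral_le_of_norm_le_const hfin.lt_top fun x _ => ?_
    rw [norm_mul]
    have h1 : ‖lineDeriv ℝ w x (-1)‖ ≤ K * ‖(-1:ℝ)‖ := norm_lineDeriv_le_of_lipschitz ℝ hw
    rw [norm_neg, norm_one, mul_one] at h1
    calc _ ≤ (K:ℝ) * 1 := mul_le_mul h1 (hφb x) (abs_nonneg _) K.coe_nonneg
      _ = K := mul_one _
  · intro x hx; rw [hz' x hx, mul_zero]

lemma aux_bv_congr (f g : ℝ → ℝ) (U : Set ℝ) (h : f =ᵐ[volume.restrict U] g) (hg : MemBV1 g U) :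
    MemBV1 f U := by
  refine ⟨hg.1.congr h.symm, ?_⟩
  have : variation1 f U = variation1 g U := by
    unfold variation1
    refine iSup_congr fun φ => iSup_congr fun _ => congrArg _ ?_
    refine integral_congr_ae ?_
    filter_upwards [h] with x hx
    rw [hx]
  rw [this]; exact hg.2

lemma aux_backward (Ω : Set ℝ) (hΩ : IsOpen Ω) (C : Set ℝ) (hC : C ⊆ Ω)
    (h : volume (closure C ∩ Ω) = 0) : GBVPolar1 C Ω := by
  rcases C.eq_empty_or_nonempty with rfl | hne
  · refine ⟨fun _ => 0, ⟨aemeasurable_const, fun m _ U hU hUc _ => ?_⟩, empty_subset _⟩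
    exact aux_lip_bv _ 0 (LipschitzWith.const _) U hU hUc
  set u : ℝ → ℝ := fun x => (infDist x C)⁻¹ with hu
  have hmeas : Measurable u := (continuous_infDist_pt C).measurable.inv
  have hae : ∀ U ⊆ Ω, MeasurableSet U → ∀ᵐ x ∂(volume.restrict U), x ∉ closure C := by
    intro U hUΩ hU
    rw [ae_restrict_iff' hU, ae_iff]
    refine measure_mono_null ?_ h
    intro x hx
    simp only [mem_ofPred_eq, Classical.not_imp, not_not] at hx
    exact ⟨hx.2, hUΩ hx.1⟩
  have hpos : ∀ x, x ∉ closure C → 0 < infDist x C := fun x hx =>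
    lt_of_le_of_ne infDist_nonneg fun h0 => hx ((mem_closure_iff_infDist_zero hne).2 h0.symm)
  refine ⟨u, ⟨hmeas.aemeasurable, fun m hm U hU hUc hUΩ => ?_⟩, fun x hx => ⟨hC hx, Or.inl ?_⟩⟩
  · have hlip : LipschitzWith (Real.toNNReal (m*m)) (fun x => (max (infDist x C) m⁻¹)⁻¹) := by
      refine LipschitzWith.of_dist_le_mul fun x y => ?_
      have hmi : 0 < m⁻¹ := inv_pos.2 hm
      have ha : m⁻¹ ≤ max (infDist x C) m⁻¹ := le_max_right _ _
      have hb : m⁻¹ ≤ max (infDist y C) m⁻¹ := le_max_right _ _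
      have hab : |max (infDist x C) m⁻¹ - max (infDist y C) m⁻¹| ≤ dist x y := by
        have h1 := abs_max_sub_max_le_abs (infDist x C) (infDist y C) m⁻¹
        have h2 := (lipschitz_infDist_pt C).dist_le_mul x y
        rw [Real.dist_eq, NNReal.coe_one, one_mul] at h2
        exact h1.trans h2
      set a := max (infDist x C) m⁻¹
      set b := max (infDist y C) m⁻¹
      have ha0 : 0 < a := lt_of_lt_of_le hmi ha
      have hb0 : 0 < b := lt_of_lt_of_le hmi hb
      have ha' : a⁻¹ ≤ m := inv_le_of_inv_le₀ hm ha
      have hb' : b⁻¹ ≤ m := inv_le_of_inv_le₀ hm hb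
      rw [Real.coe_toNNReal _ (by positivity), Real.dist_eq, inv_sub_inv ha0.ne' hb0.ne', abs_div,
        abs_of_pos (mul_pos ha0 hb0), abs_sub_comm, div_eq_mul_inv, mul_inv, mul_comm]
      gcongr
    refine aux_bv_congr _ _ U ?_ (aux_lip_bv _ _ hlip U hU hUc)
    filter_upwards [hae U (subset_closure.trans hUΩ) hU.measurableSet] with x hx
    have hd := hpos x hx
    have hu0 : 0 < (infDist x C)⁻¹ := inv_pos.2 hd
    simp only [hu]
    rw [max_eq_right (by have := lt_min hu0 hm; linarith)]
    rcases le_total (infDist x C) m⁻¹ with h1 | h1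
    · rw [max_eq_right h1, inv_inv, min_eq_right ((le_inv_comm₀ hm hd).2 h1)]
    · rw [max_eq_left h1, min_eq_left (inv_le_of_inv_le₀ hm h1)]
  · -- near `x`, `u` is large almost everywhere
    have key : ∀ s : ℝ, ∃ r > 0, ∀ y ∈ ball x r, y ∈ Ω ∧ (y ∉ closure C → s < u y) := by
      intro s
      obtain ⟨r, hr, hrs⟩ := Metric.mem_nhds_iff.1 (hΩ.mem_nhds (hC hx))
      refine ⟨min r (|s|+1)⁻¹, lt_min hr (by positivity), fun y hy => ⟨hrs (ball_subset_ball (min_le_left _ _) hy), fun hyC => ?_⟩⟩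
      have h1 : infDist y C < (|s|+1)⁻¹ :=
        lt_of_le_of_lt (infDist_le_dist_of_mem hx) (lt_of_lt_of_le hy (min_le_right _ _))
      have h2 : |s| + 1 < u y := (lt_inv_comm₀ (by positivity) (hpos y hyC)).2 h1
      linarith [le_abs_self s]
    have hnull : ∀ D : Set ℝ, D ⊆ Ω → D ⊆ closure C → volume D = 0 := fun D h1 h2 =>
      measure_mono_null (subset_inter h2 h1) h
    have hev : ∀ r > (0:ℝ), ∀ᶠ ρ : ℝ in 𝓝[>] 0, 0 < ρ ∧ ρ < r := fun r hr =>
      inter_mem self_mem_nhdsWithin (mem_nhdsWithin_of_mem_nhds (gt_mem_nhds hr))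
    constructor
    · unfold approxUpper1
      rw [sInf_eq_top]
      rintro _ ⟨s, rfl, hs⟩
      exfalso
      unfold HasDensity1 at hs
      rw [ENNReal.ofReal_zero] at hs
      obtain ⟨r, hr, hrs⟩ := key s
      obtain ⟨ρ, hρ, hρ0, hρr⟩ := ((hs.eventually (gt_mem_nhds zero_lt_one)).and (hev r hr)).exists
      have hle : volume (ball x ρ) ≤ volume ({y | y ∈ Ω ∧ s < u y} ∩ ball x ρ) := by
        calc volume (ball x ρ) ≤ volume (({y | y ∈ Ω ∧ s < u y} ∩ ball x ρ) ∪ (closure C ∩ Ω)) := by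
              refine measure_mono fun y hy => ?_
              obtain ⟨h1, h2⟩ := hrs y (ball_subset_ball hρr.le hy)
              by_cases hyC : y ∈ closure C
              · exact Or.inr ⟨hyC, h1⟩
              · exact Or.inl ⟨⟨h1, h2 hyC⟩, hy⟩
          _ ≤ _ := measure_union_le _ _
          _ = _ := by rw [h, add_zero]
      have : 1 ≤ volume ({y | y ∈ Ω ∧ s < u y} ∩ ball x ρ) / volume (ball x ρ) := by
        rw [← ENNReal.div_self (measure_ball_pos volume x hρ0).ne' measure_ball_lt_top.ne]
        gcongr
      exact absurd hρ (not_lt.2 this)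
    · unfold approxLower1
      rw [EReal.eq_top_iff_forall_lt]
      intro M
      refine lt_of_lt_of_le (EReal.coe_lt_coe_iff.2 (lt_add_one M)) (le_sSup (show ((M + 1 : ℝ) : EReal) ∈ {t : EReal | ∃ s : ℝ, t = (s : EReal) ∧
        HasDensity1 {y | y ∈ Ω ∧ u y < s} x 0} from ⟨M + 1, rfl, ?_⟩))
      unfold HasDensity1
      rw [ENNReal.ofReal_zero]
      obtain ⟨r, hr, hrs⟩ := key (M+1)
      refine tendsto_const_nhds.congr' ?_
      filter_upwards [hev r hr] with ρ hρ
      rw [hnull, ENNReal.zero_div]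
      · exact fun y hy => hy.1.1
      · intro y hy
        by_contra hyC
        exact absurd ((hrs y (ball_subset_ball hρ.2.le hy.2)).2 hyC) (not_lt.2 hy.1.2.le)

/-- for `C ⊆ Ω ⊆ ℝ` with `Ω` open, `C` is `GBV`-polar in `Ω` if and only if
`λ¹(cl(C) ∩ Ω) = 0`. -/
theorem statement4 (Ω : Set ℝ) (hΩ : IsOpen Ω) (C : Set ℝ) (hC : C ⊆ Ω) :
    GBVPolar1 C Ω ↔ volume (closure C ∩ Ω) = 0 := by
  exact ⟨aux_forward Ω hΩ C, aux_backward Ω hΩ C hC⟩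
end
end
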